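/- arXiv:2006.01218 — 6 statements merged into one kernel-verified Lean document; each statement's English description precedes it below -/
import Mathlib

section
/- The quotient k-vector space {(a,b) ∈ U₁ × U₁ : [x,b] = [y,a]} / {([x,u],[y,u]) : u ∈ U₀} has dimension 5, and the quotient k-vector space {(a,b) ∈ U₂ × U₂ : [x,b] = [y,a]} / {([x,u],[y,u]) : u ∈ U₁} has dimension 8. (These are the homogeneous components of degrees 0 and 1 of the Hochschild cohomology H¹(S,U).) -/
/-!
Let `k` be a field of characteristic zero, `t ∈ k`, `t ≠ 0`, and let `U = Diff 𝒜` be the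
algebra presented by generators `x, y, D, E` and relations `[y,x] = 0`, `[D,x] = 0`,
`[D,y] = y² + txy`, `[E,x] = x`, `[E,y] = y`, `[E,D] = D`, graded with
`|x| = |y| = |D| = 1`, `|E| = 0`.  Then
`{(a,b) ∈ U₁×U₁ : [x,b]=[y,a]} / {([x,u],[y,u]) : u ∈ U₀}` has dimension `5`, and
`{(a,b) ∈ U₂×U₂ : [x,b]=[y,a]} / {([x,u],[y,u]) : u ∈ U₁}` has dimension `8`.
-/

/-- Relations presenting `Diff 𝒜`; the generators are `x = ι 0`, `y = ι 1`, `D = ι 2`,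
`E = ι 3`. -/
inductive DiffRel (k : Type) [Field k] (t : k) :
    FreeAlgebra k (Fin 4) → FreeAlgebra k (Fin 4) → Prop
  | yx : DiffRel k t (FreeAlgebra.ι k 1 * FreeAlgebra.ι k 0)
      (FreeAlgebra.ι k 0 * FreeAlgebra.ι k 1)
  | Dx : DiffRel k t (FreeAlgebra.ι k 2 * FreeAlgebra.ι k 0)
      (FreeAlgebra.ι k 0 * FreeAlgebra.ι k 2)
  | Dy : DiffRel k t (FreeAlgebra.ι k 2 * FreeAlgebra.ι k 1)
      (FreeAlgebra.ι k 1 * FreeAlgebra.ι k 2 +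
        (FreeAlgebra.ι k 1 * FreeAlgebra.ι k 1 + t • (FreeAlgebra.ι k 0 * FreeAlgebra.ι k 1)))
  | Ex : DiffRel k t (FreeAlgebra.ι k 3 * FreeAlgebra.ι k 0)
      (FreeAlgebra.ι k 0 * FreeAlgebra.ι k 3 + FreeAlgebra.ι k 0)
  | Ey : DiffRel k t (FreeAlgebra.ι k 3 * FreeAlgebra.ι k 1)
      (FreeAlgebra.ι k 1 * FreeAlgebra.ι k 3 + FreeAlgebra.ι k 1)
  | ED : DiffRel k t (FreeAlgebra.ι k 3 * FreeAlgebra.ι k 2)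
      (FreeAlgebra.ι k 2 * FreeAlgebra.ι k 3 + FreeAlgebra.ι k 2)

/-- The algebra `Diff 𝒜` of differential operators tangent to a central arrangement of
three lines. -/
abbrev DiffA (k : Type) [Field k] (t : k) : Type := RingQuot (DiffRel k t)

variable (k : Type) [Field k] (t : k)

/-- The generator `x` of `Diff 𝒜`. -/
noncomputable def genX : DiffA k t := RingQuot.mkAlgHom k (DiffRel k t) (FreeAlgebra.ι k 0)

/-- The generator `y` of `Diff 𝒜`. -/
noncomputable def genY : DiffA k t := RingQuot.mkAlgHom k (DiffRel k t) (FreeAlgebra.ι k 1)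

/-- The generator `D` of `Diff 𝒜`. -/
noncomputable def genD : DiffA k t := RingQuot.mkAlgHom k (DiffRel k t) (FreeAlgebra.ι k 2)

/-- The generator `E` of `Diff 𝒜`. -/
noncomputable def genE : DiffA k t := RingQuot.mkAlgHom k (DiffRel k t) (FreeAlgebra.ι k 3)

/-- `U₀ = span{Eʲ}`, the degree-`0` homogeneous component of `U`. -/
noncomputable def deg0 : Submodule k (DiffA k t) :=
  Submodule.span k {w | ∃ j : ℕ, w = genE k t ^ j}

/-- `U₁ = span{xEʲ, yEʲ, DEʲ}`, the degree-`1` homogeneous component of `U`. -/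
noncomputable def deg1 : Submodule k (DiffA k t) :=
  Submodule.span k {w | ∃ j : ℕ,
    w = genX k t * genE k t ^ j ∨ w = genY k t * genE k t ^ j ∨ w = genD k t * genE k t ^ j}

/-- `U₂ = span{x²Eʲ, xyEʲ, y²Eʲ, xDEʲ, yDEʲ, D²Eʲ}`, the degree-`2` homogeneous
component of `U`. -/
noncomputable def deg2 : Submodule k (DiffA k t) :=
  Submodule.span k {w | ∃ j : ℕ,
    w = genX k t ^ 2 * genE k t ^ j ∨ w = genX k t * genY k t * genE k t ^ j ∨
    w = genY k t ^ 2 * genE k t ^ j ∨ w = genX k t * genD k t * genE k t ^ j ∨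
    w = genY k t * genD k t * genE k t ^ j ∨ w = genD k t ^ 2 * genE k t ^ j}

/-- The `k`-linear map `(a, b) ↦ [x, b] − [y, a]` on `U × U`. -/
noncomputable def cocycleMap : DiffA k t × DiffA k t →ₗ[k] DiffA k t :=
  (LinearMap.mulLeft k (genX k t) - LinearMap.mulRight k (genX k t)).comp
      (LinearMap.snd k (DiffA k t) (DiffA k t)) -
    (LinearMap.mulLeft k (genY k t) - LinearMap.mulRight k (genY k t)).comp
      (LinearMap.fst k (DiffA k t) (DiffA k t))

/-- The `k`-linear map `u ↦ ([x, u], [y, u])` on `U`. -/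
noncomputable def coboundaryMap : DiffA k t →ₗ[k] DiffA k t × DiffA k t :=
  LinearMap.prod (LinearMap.mulLeft k (genX k t) - LinearMap.mulRight k (genX k t))
    (LinearMap.mulLeft k (genY k t) - LinearMap.mulRight k (genY k t))

/-- The space of degree-`n` cocycles `{(a, b) ∈ Uₙ × Uₙ : [x, b] = [y, a]}`. -/
noncomputable def cocycles (W : Submodule k (DiffA k t)) :
    Submodule k (DiffA k t × DiffA k t) :=
  W.prod W ⊓ LinearMap.ker (cocycleMap k t)

set_option linter.unusedSimpArgs false

open Polynomial in
theorem hs_delta_const [CharZero k] (f : k[X]) (h : f.comp (X + 1) = f) : ∃ c, f = C c := by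
  refine ⟨f.eval 0, ?_⟩
  have h1 : ∀ n : ℕ, f.eval (n : k) = f.eval 0 := by
    intro n
    induction n with
    | zero => simp
    | succ n ih =>
      rw [← ih]
      conv_rhs => rw [← h]
      simp
  have hinj : Function.Injective (fun n : ℕ => (n : k)) := Nat.cast_injective
  apply Polynomial.eq_of_infinite_eval_eq
  apply (Set.infinite_range_of_injective hinj).mono
  rintro _ ⟨n, rfl⟩
  simp [h1 n]

open Polynomial in
theorem hs_delta_surj [CharZero k] (g : k[X]) : ∃ f : k[X], f.comp (X + 1) - f = g := by
  induction g using Polynomial.induction_on' with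
  | add p q hp hq =>
    obtain ⟨a, ha⟩ := hp
    obtain ⟨b, hb⟩ := hq
    refine ⟨a + b, ?_⟩
    rw [← ha, ← hb, add_comp]; ring
  | monomial n c =>
    have h := Polynomial.bernoulli_comp_one_add_X (n + 1)
    have h2 := congrArg (Polynomial.map (algebraMap ℚ k)) h
    simp only [Polynomial.map_comp, Polynomial.map_add, Polynomial.map_one, Polynomial.map_X,
      Polynomial.map_pow, nsmul_eq_mul, Polynomial.map_mul,
      Polynomial.map_natCast, Nat.add_sub_cancel] at h2
    refine ⟨C (c / (n + 1)) * Polynomial.map (algebraMap ℚ k) (Polynomial.bernoulli (n + 1)), ?_⟩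
    rw [mul_comp, C_comp, add_comm X 1, h2]
    have hn : (n + 1 : k) ≠ 0 := by exact_mod_cast Nat.succ_ne_zero n
    have : (C (c / (n + 1)) : k[X]) * ((n + 1 : ℕ) : k[X]) = C c := by
      rw [← Polynomial.C_eq_natCast, ← C_mul]
      congr 1
      push_cast
      field_simp
    rw [← C_mul_X_pow_eq_monomial, ← this]
    ring

theorem hs_yx : genY k t * genX k t = genX k t * genY k t := by
  have := RingQuot.mkAlgHom_rel k (DiffRel.yx (k := k) (t := t))
  simp only [map_mul, map_add, map_smul] at this
  exact this

theorem hs_Dx : genD k t * genX k t = genX k t * genD k t := by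
  have := RingQuot.mkAlgHom_rel k (DiffRel.Dx (k := k) (t := t))
  simp only [map_mul, map_add, map_smul] at this
  exact this

theorem hs_Dy : genD k t * genY k t = genY k t * genD k t +
    (genY k t * genY k t + t • (genX k t * genY k t)) := by
  have := RingQuot.mkAlgHom_rel k (DiffRel.Dy (k := k) (t := t))
  simp only [map_mul, map_add, map_smul] at this
  exact this

theorem hs_Ex : genE k t * genX k t = genX k t * genE k t + genX k t := by
  have := RingQuot.mkAlgHom_rel k (DiffRel.Ex (k := k) (t := t))
  simp only [map_mul, map_add, map_smul] at this
  exact this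

theorem hs_Ey : genE k t * genY k t = genY k t * genE k t + genY k t := by
  have := RingQuot.mkAlgHom_rel k (DiffRel.Ey (k := k) (t := t))
  simp only [map_mul, map_add, map_smul] at this
  exact this

theorem hs_ED : genE k t * genD k t = genD k t * genE k t + genD k t := by
  have := RingQuot.mkAlgHom_rel k (DiffRel.ED (k := k) (t := t))
  simp only [map_mul, map_add, map_smul] at this
  exact this

open Polynomial in
theorem hs_comm (v : DiffA k t) (hv : genE k t * v = v * genE k t + v) (f : k[X]) :
    aeval (genE k t) f * v = v * aeval (genE k t) (f.comp (X + 1)) := by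
  induction f using Polynomial.induction_on with
  | C a => simp [Algebra.commutes]
  | add p q hp hq => simp only [map_add, add_comp, add_mul, mul_add, hp, hq]
  | monomial n a ih =>
    have e1 : (C a * X ^ (n + 1) : k[X]) = X * (C a * X ^ n) := by ring
    rw [e1, mul_comp, X_comp, map_mul _ X, map_mul _ (X + 1), mul_assoc, ih, ← mul_assoc, aeval_X, hv]
    simp only [map_add, aeval_X, map_one]
    noncomm_ring

/-- Operators on `k[e][x,y,d]`. -/
abbrev HsR : Type := MvPolynomial (Fin 3) (Polynomial k)

/-- The derivation `δ`. -/
noncomputable def hsDel : Derivation (Polynomial k) (HsR k) (HsR k) :=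
  MvPolynomial.mkDerivation (Polynomial k)
    ![0, MvPolynomial.X 1 * MvPolynomial.X 1 +
      MvPolynomial.C (Polynomial.C t) * (MvPolynomial.X 0 * MvPolynomial.X 1), 0]

/-- The Euler derivation. -/
noncomputable def hsEu : Derivation (Polynomial k) (HsR k) (HsR k) :=
  MvPolynomial.mkDerivation (Polynomial k) MvPolynomial.X

theorem hs_comm_der (p : HsR k) : hsEu k (hsDel k t p) = hsDel k t (hsEu k p) + hsDel k t p := by
  have : ⁅hsEu k, hsDel k t⁆ = hsDel k t := by
    apply MvPolynomial.derivation_ext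
    intro i
    rw [Derivation.commutator_apply]
    fin_cases i <;>
      simp [hsEu, hsDel, MvPolynomial.mkDerivation_X, ← MvPolynomial.algebraMap_eq]
    ring
  have h2 := congrArg (fun d => d p) this
  simp only [Derivation.commutator_apply] at h2
  rw [← sub_eq_iff_eq_add', h2]

/-- The images of the generators. -/
noncomputable def hsGen : Fin 4 → Module.End k (HsR k) :=
  ![LinearMap.mulLeft k (MvPolynomial.X 0), LinearMap.mulLeft k (MvPolynomial.X 1),
    LinearMap.mulLeft k (MvPolynomial.X 2) + (hsDel k t).toLinearMap.restrictScalars k,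
    LinearMap.mulLeft k (MvPolynomial.C Polynomial.X) + (hsEu k).toLinearMap.restrictScalars k]

theorem hs_C (c : Polynomial k) (D : Derivation (Polynomial k) (HsR k) (HsR k)) :
    D (MvPolynomial.C c) = 0 := by
  rw [← MvPolynomial.algebraMap_eq]; exact D.map_algebraMap c

theorem hs_smul (c : k) (p : HsR k) : c • p = MvPolynomial.C (Polynomial.C c) * p := by
  rw [← MvPolynomial.smul_eq_C_mul, ← Polynomial.algebraMap_eq, algebraMap_smul]

/-- The representation. -/
noncomputable def hsRep : DiffA k t →ₐ[k] Module.End k (HsR k) :=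
  RingQuot.liftAlgHom k ⟨FreeAlgebra.lift k (hsGen k t), by
    intro a b h
    cases h <;> refine LinearMap.ext fun p => ?_
    all_goals
      simp [hsGen, hs_comm_der, hs_smul]
    · ring
    · simp [hsDel, MvPolynomial.mkDerivation_X]; ring
    · simp [hsDel, MvPolynomial.mkDerivation_X]; ring
    · simp [hsEu, MvPolynomial.mkDerivation_X]; ring
    · simp [hsEu, MvPolynomial.mkDerivation_X]; ring
    · simp [hsEu, hsDel, MvPolynomial.mkDerivation_X]; ring⟩

theorem hs_repX (p : HsR k) : hsRep k t (genX k t) p = MvPolynomial.X 0 * p := by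
  simp [hsRep, genX, hsGen]
theorem hs_repY (p : HsR k) : hsRep k t (genY k t) p = MvPolynomial.X 1 * p := by
  simp [hsRep, genY, hsGen]
theorem hs_repD (p : HsR k) : hsRep k t (genD k t) p = MvPolynomial.X 2 * p + hsDel k t p := by
  simp [hsRep, genD, hsGen]
theorem hs_repE (p : HsR k) :
    hsRep k t (genE k t) p = MvPolynomial.C Polynomial.X * p + hsEu k p := by
  simp [hsRep, genE, hsGen]

theorem hs_rep_aeval (f g : Polynomial k) :
    hsRep k t (Polynomial.aeval (genE k t) f) (MvPolynomial.C g) = MvPolynomial.C (f * g) := by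
  induction f using Polynomial.induction_on generalizing g with
  | C a => simp [Module.algebraMap_end_apply, hs_smul]
  | add p q hp hq => simp [hp, hq, add_mul]
  | monomial n a ih =>
    rw [pow_succ, ← mul_assoc, map_mul, map_mul, Module.End.mul_apply, Polynomial.aeval_X,
      hs_repE, hs_C, add_zero, ← MvPolynomial.C_mul, ih]
    congr 1; ring

/-- PBW monomials. -/
noncomputable def hsMon (e : ℕ × ℕ × ℕ) : DiffA k t :=
  genX k t ^ e.1 * genY k t ^ e.2.1 * genD k t ^ e.2.2

/-- Exponent vector. -/
noncomputable def hsExp (e : ℕ × ℕ × ℕ) : Fin 3 →₀ ℕ :=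
  Finsupp.equivFunOnFinite.symm ![e.1, e.2.1, e.2.2]

theorem hs_exp_inj : Function.Injective hsExp := by
  intro a b h
  have h' := Finsupp.equivFunOnFinite.symm.injective h
  have h0 := congrFun h' 0
  have h1 := congrFun h' 1
  have h2 := congrFun h' 2
  simp at h0 h1 h2
  exact Prod.ext h0 (Prod.ext h1 h2)

theorem hs_repX_pow (n : ℕ) (p : HsR k) :
    hsRep k t (genX k t ^ n) p = MvPolynomial.X 0 ^ n * p := by
  induction n generalizing p with
  | zero => simp
  | succ n ih => rw [pow_succ, map_mul, Module.End.mul_apply, hs_repX, ih]; ring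

theorem hs_repY_pow (n : ℕ) (p : HsR k) :
    hsRep k t (genY k t ^ n) p = MvPolynomial.X 1 ^ n * p := by
  induction n generalizing p with
  | zero => simp
  | succ n ih => rw [pow_succ, map_mul, Module.End.mul_apply, hs_repY, ih]; ring

theorem hs_repD_pow (n : ℕ) (g : Polynomial k) :
    hsRep k t (genD k t ^ n) (MvPolynomial.C g) = MvPolynomial.X 2 ^ n * MvPolynomial.C g := by
  induction n with
  | zero => simp
  | succ n ih =>
    rw [pow_succ', map_mul, Module.End.mul_apply, ih, hs_repD]
    have : hsDel k t (MvPolynomial.X 2 ^ n * MvPolynomial.C g) = 0 := by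
      rw [Derivation.leibniz, hs_C, Derivation.leibniz_pow]
      simp [hsDel, MvPolynomial.mkDerivation_X]
    rw [this]; ring

theorem hs_rep_mon (e : ℕ × ℕ × ℕ) (f : Polynomial k) :
    hsRep k t (hsMon k t e * Polynomial.aeval (genE k t) f) 1 =
      MvPolynomial.monomial (hsExp e) f := by
  have h := hs_rep_aeval k t f 1
  rw [MvPolynomial.C_1] at h
  rw [hsMon, map_mul, Module.End.mul_apply, h, map_mul, map_mul, Module.End.mul_apply,
    Module.End.mul_apply, hs_repD_pow, hs_repY_pow, hs_repX_pow, MvPolynomial.monomial_eq]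
  rw [Finsupp.prod_fintype _ _ (by simp), Fin.prod_univ_three]
  simp [hsExp]
  ring

/-- The parametrisation of homogeneous components. -/
noncomputable def hsP {n : ℕ} (e : Fin n → ℕ × ℕ × ℕ) :
    (Fin n → Polynomial k) →ₗ[k] DiffA k t :=
  ∑ i, (LinearMap.mulLeft k (hsMon k t (e i))).comp
    ((Polynomial.aeval (genE k t)).toLinearMap.comp (LinearMap.proj i))

theorem hsP_apply {n : ℕ} (e : Fin n → ℕ × ℕ × ℕ) (c : Fin n → Polynomial k) :
    hsP k t e c = ∑ i, hsMon k t (e i) * Polynomial.aeval (genE k t) (c i) := by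
  simp [hsP]

theorem hsP_inj {n : ℕ} (e : Fin n → ℕ × ℕ × ℕ) (he : Function.Injective e) :
    Function.Injective (hsP k t e) := by
  rw [← LinearMap.ker_eq_bot, LinearMap.ker_eq_bot']
  intro c hc
  have h := congrArg (fun u => hsRep k t u 1) hc
  simp only [hsP_apply, map_sum, LinearMap.sum_apply, hs_rep_mon, map_zero,
    LinearMap.zero_apply] at h
  funext i
  have h2 := congrArg (MvPolynomial.coeff (hsExp (e i))) h
  rw [MvPolynomial.coeff_sum, Finset.sum_eq_single i] at h2
  · simpa using h2
  · intro j _ hj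
    rw [MvPolynomial.coeff_monomial, if_neg]
    exact fun hh => hj (he (hs_exp_inj hh))
  · simp

theorem hsP_range {n : ℕ} (e : Fin n → ℕ × ℕ × ℕ) :
    LinearMap.range (hsP k t e) =
      Submodule.span k {w | ∃ j : ℕ, ∃ i, w = hsMon k t (e i) * genE k t ^ j} := by
  apply le_antisymm
  · rintro _ ⟨c, rfl⟩
    rw [hsP_apply]
    refine Submodule.sum_mem _ fun i _ => ?_
    rw [Polynomial.aeval_eq_sum_range, Finset.mul_sum]
    refine Submodule.sum_mem _ fun j _ => ?_
    rw [mul_smul_comm]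
    exact Submodule.smul_mem _ _ (Submodule.subset_span ⟨j, i, rfl⟩)
  · rw [Submodule.span_le]
    rintro _ ⟨j, i, rfl⟩
    refine ⟨Pi.single i (Polynomial.X ^ j), ?_⟩
    rw [hsP_apply, Finset.sum_eq_single i]
    · simp
    · intro l _ hl
      simp [Pi.single_eq_of_ne hl]
    · simp

/-- Exponents in degree `0`. -/
def hsE0 : Fin 1 → ℕ × ℕ × ℕ := ![(0, 0, 0)]
/-- Exponents in degree `1`. -/
def hsE1 : Fin 3 → ℕ × ℕ × ℕ := ![(1, 0, 0), (0, 1, 0), (0, 0, 1)]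
/-- Exponents in degree `2`. -/
def hsE2 : Fin 6 → ℕ × ℕ × ℕ :=
  ![(2, 0, 0), (1, 1, 0), (0, 2, 0), (1, 0, 1), (0, 1, 1), (0, 0, 2)]
/-- Exponents in degree `3`. -/
def hsE3 : Fin 9 → ℕ × ℕ × ℕ :=
  ![(3, 0, 0), (2, 1, 0), (1, 2, 0), (0, 3, 0), (2, 0, 1), (1, 1, 1), (0, 2, 1),
    (1, 0, 2), (0, 1, 2)]

theorem hs_deg0 : deg0 k t = LinearMap.range (hsP k t hsE0) := by
  rw [hsP_range, deg0]
  congr 1; ext w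
  simp [hsE0, hsMon]

theorem hs_deg1 : deg1 k t = LinearMap.range (hsP k t hsE1) := by
  rw [hsP_range, deg1]
  congr 1; ext w
  simp [hsE1, hsMon, Fin.exists_fin_succ]

theorem hs_deg2 : deg2 k t = LinearMap.range (hsP k t hsE2) := by
  rw [hsP_range, deg2]
  congr 1; ext w
  simp [hsE2, hsMon, Fin.exists_fin_succ]

theorem hs_finrank {M : Type*} [AddCommGroup M] [Module k M] (n : ℕ) (B Z : Submodule k M)
    (L : (Fin n → k) →ₗ[k] M) (h1 : ∀ v, L v ∈ Z) (h2 : ∀ v, L v ∈ B → v = 0)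
    (h3 : ∀ z ∈ Z, ∃ v, z - L v ∈ B) :
    Module.finrank k (LinearMap.range (B.mkQ.comp Z.subtype)) = n := by
  have hr : LinearMap.range (B.mkQ.comp Z.subtype) = LinearMap.range (B.mkQ.comp L) := by
    apply le_antisymm
    · rintro _ ⟨⟨z, hz⟩, rfl⟩
      obtain ⟨v, hv⟩ := h3 z hz
      refine ⟨v, ?_⟩
      simp only [LinearMap.comp_apply, Submodule.subtype_apply, Submodule.mkQ_apply]
      exact ((Submodule.Quotient.eq B).2 hv).symm
    · rintro _ ⟨v, rfl⟩
      exact ⟨⟨L v, h1 v⟩, rfl⟩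
  rw [hr, LinearMap.finrank_range_of_inj]
  · simp
  · rw [← LinearMap.ker_eq_bot, LinearMap.ker_eq_bot']
    intro v hv
    apply h2
    simpa using hv

theorem hs_C2 : (Polynomial.C (2 : k)) = 2 := map_ofNat Polynomial.C 2
theorem hs_C3 : (Polynomial.C (3 : k)) = 3 := map_ofNat Polynomial.C 3

theorem hs_yx' (z : DiffA k t) : genY k t * (genX k t * z) = genX k t * (genY k t * z) := by
  rw [← mul_assoc, hs_yx, mul_assoc]

theorem hs_Dx' (z : DiffA k t) : genD k t * (genX k t * z) = genX k t * (genD k t * z) := by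
  rw [← mul_assoc, hs_Dx, mul_assoc]

theorem hs_Dy' (z : DiffA k t) : genD k t * (genY k t * z) = genY k t * (genD k t * z) +
    (genY k t * (genY k t * z) + t • (genX k t * (genY k t * z))) := by
  rw [← mul_assoc, hs_Dy]
  simp only [add_mul, smul_mul_assoc, mul_assoc]

open Polynomial in
theorem hs_coc1 (a b : Fin 3 → k[X]) :
    cocycleMap k t (hsP k t hsE1 a, hsP k t hsE1 b) = hsP k t hsE2
      ![b 0 - (b 0).comp (X + 1),
        (b 1 - (b 1).comp (X + 1)) + ((a 0).comp (X + 1) - a 0) + t • (a 2).comp (X + 1),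
        ((a 1).comp (X + 1) - a 1) + (a 2).comp (X + 1),
        b 2 - (b 2).comp (X + 1),
        (a 2).comp (X + 1) - a 2, 0] := by
  have hx := fun f => hs_comm k t (genX k t) (hs_Ex k t) f
  have hy := fun f => hs_comm k t (genY k t) (hs_Ey k t) f
  simp [cocycleMap, hsP_apply, Fin.sum_univ_succ, hsE1, hsE2, hsMon, pow_succ]
  simp only [mul_add, add_mul, mul_sub, mul_assoc, hx, hy, hs_yx, hs_yx', hs_Dx, hs_Dx', hs_Dy,
    hs_Dy', mul_smul_comm, smul_mul_assoc, smul_add]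
  module

open Polynomial in
theorem hs_coc2 (a b : Fin 6 → k[X]) :
    cocycleMap k t (hsP k t hsE2 a, hsP k t hsE2 b) = hsP k t hsE3
      ![b 0 - (b 0).comp (X + 1),
        (b 1 - (b 1).comp (X + 1)) + ((a 0).comp (X + 1) - a 0) + t • (a 3).comp (X + 1)
          + (t * t) • (a 5).comp (X + 1),
        (b 2 - (b 2).comp (X + 1)) + ((a 1).comp (X + 1) - a 1) + (a 3).comp (X + 1)
          + t • (a 4).comp (X + 1) + (3 * t) • (a 5).comp (X + 1),
        ((a 2).comp (X + 1) - a 2) + (a 4).comp (X + 1) + (2 : k) • (a 5).comp (X + 1),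
        b 3 - (b 3).comp (X + 1),
        (b 4 - (b 4).comp (X + 1)) + ((a 3).comp (X + 1) - a 3) + (2 * t) • (a 5).comp (X + 1),
        ((a 4).comp (X + 1) - a 4) + (2 : k) • (a 5).comp (X + 1),
        b 5 - (b 5).comp (X + 1),
        (a 5).comp (X + 1) - a 5] := by
  have hx := fun f => hs_comm k t (genX k t) (hs_Ex k t) f
  have hy := fun f => hs_comm k t (genY k t) (hs_Ey k t) f
  simp [cocycleMap, hsP_apply, Fin.sum_univ_succ, hsE2, hsE3, hsMon, pow_succ]
  simp only [mul_add, add_mul, mul_sub, mul_assoc, hx, hy, hs_yx, hs_yx', hs_Dx, hs_Dx', hs_Dy,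
    hs_Dy', mul_smul_comm, smul_mul_assoc, smul_add]
  module

open Polynomial in
theorem hs_cob0 (f : Fin 1 → k[X]) :
    coboundaryMap k t (hsP k t hsE0 f) =
      (hsP k t hsE1 ![f 0 - (f 0).comp (X + 1), 0, 0],
       hsP k t hsE1 ![0, f 0 - (f 0).comp (X + 1), 0]) := by
  have hx := fun f => hs_comm k t (genX k t) (hs_Ex k t) f
  have hy := fun f => hs_comm k t (genY k t) (hs_Ey k t) f
  simp [coboundaryMap, hsP_apply, Fin.sum_univ_succ, hsE0, hsE1, hsMon, hx, hy, mul_sub]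

open Polynomial in
theorem hs_cob1 (f : Fin 3 → k[X]) :
    coboundaryMap k t (hsP k t hsE1 f) =
      (hsP k t hsE2 ![f 0 - (f 0).comp (X + 1), f 1 - (f 1).comp (X + 1), 0,
        f 2 - (f 2).comp (X + 1), 0, 0],
       hsP k t hsE2 ![0, f 0 - (f 0).comp (X + 1) - t • (f 2).comp (X + 1),
        f 1 - (f 1).comp (X + 1) - (f 2).comp (X + 1), 0, f 2 - (f 2).comp (X + 1), 0]) := by
  have hx := fun f => hs_comm k t (genX k t) (hs_Ex k t) f
  have hy := fun f => hs_comm k t (genY k t) (hs_Ey k t) f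
  simp [coboundaryMap, hsP_apply, Fin.sum_univ_succ, hsE1, hsE2, hsMon, pow_succ]
  simp only [mul_add, add_mul, mul_sub, mul_assoc, hx, hy, hs_yx, hs_yx', hs_Dx, hs_Dx', hs_Dy,
    hs_Dy', mul_smul_comm, smul_mul_assoc, smul_add]
  constructor <;> module

theorem hs_inj1 : Function.Injective (hsP k t hsE1) := hsP_inj k t _ (by decide)
theorem hs_inj2 : Function.Injective (hsP k t hsE2) := hsP_inj k t _ (by decide)
theorem hs_inj3 : Function.Injective (hsP k t hsE3) := hsP_inj k t _ (by decide)

open Polynomial in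
/-- First components, degree `1`. -/
noncomputable def hsA1 : (Fin 5 → k) →ₗ[k] (Fin 3 → k[X]) where
  toFun v := ![0, -(C (v 0) * X) + C (v 1), C (v 0)]
  map_add' u v := by funext i; fin_cases i <;> simp; ring
  map_smul' c v := by funext i; fin_cases i <;> simp [smul_eq_C_mul, hs_C2, hs_C3]; ring

open Polynomial in
/-- Second components, degree `1`. -/
noncomputable def hsB1 : (Fin 5 → k) →ₗ[k] (Fin 3 → k[X]) where
  toFun v := ![C (v 2), C t * C (v 0) * X + C (v 3), C (v 4)]
  map_add' u v := by funext i; fin_cases i <;> simp; ring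
  map_smul' c v := by funext i; fin_cases i <;> simp [smul_eq_C_mul, hs_C2, hs_C3]; ring

open Polynomial in
/-- First components, degree `2`. -/
noncomputable def hsA2 : (Fin 8 → k) →ₗ[k] (Fin 6 → k[X]) where
  toFun v := ![0, 0, C (v 0) * (X * (X - 1)) - C (v 1) * X + C (v 2), 0,
    -(2 * C (v 0) * X) + C (v 1), C (v 0)]
  map_add' u v := by funext i; fin_cases i <;> simp <;> ring
  map_smul' c v := by funext i; fin_cases i <;> simp [smul_eq_C_mul, hs_C2, hs_C3] <;> ring

open Polynomial in
/-- Second components, degree `2`. -/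
noncomputable def hsB2 : (Fin 8 → k) →ₗ[k] (Fin 6 → k[X]) where
  toFun v := ![C (v 3), C t * C t * C (v 0) * X + C (v 4),
    -(C t * C (v 0) * (X * (X - 1))) + C t * C (v 1) * X + C t * C (v 0) * X,
    C (v 5), 2 * C t * C (v 0) * X + C (v 6), C (v 7)]
  map_add' u v := by funext i; fin_cases i <;> simp <;> ring
  map_smul' c v := by funext i; fin_cases i <;> simp [smul_eq_C_mul, hs_C2, hs_C3] <;> ring

theorem hs_coc_iff {n : ℕ} (e : Fin n → ℕ × ℕ × ℕ) (a b : Fin n → Polynomial k) :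
    (hsP k t e a, hsP k t e b) ∈ cocycles k t (LinearMap.range (hsP k t e)) ↔
      cocycleMap k t (hsP k t e a, hsP k t e b) = 0 := by
  simp [cocycles]

open Polynomial in
theorem hs_dim1 [CharZero k] : Module.finrank k
      (LinearMap.range ((Submodule.map (coboundaryMap k t) (deg0 k t)).mkQ.comp
        (cocycles k t (deg1 k t)).subtype)) = 5 := by
  apply hs_finrank k 5 _ _
    (LinearMap.prod ((hsP k t hsE1).comp (hsA1 k)) ((hsP k t hsE1).comp (hsB1 k t)))
  · intro v
    rw [hs_deg1]
    refine (hs_coc_iff k t _ _ _).2 ?_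
    rw [hs_coc1]
    convert map_zero (hsP k t hsE2) using 2
    funext i
    fin_cases i <;> simp [hsA1, hsB1, smul_eq_C_mul, hs_C2, hs_C3] <;> ring
  · rw [hs_deg0]
    rintro v ⟨_, ⟨f, rfl⟩, h⟩
    rw [hs_cob0] at h
    have ha := hs_inj1 k t (congrArg Prod.fst h)
    have hb := hs_inj1 k t (congrArg Prod.snd h)
    have ha0 := congrFun ha 0
    have ha1 := congrFun ha 1
    have ha2 := congrFun ha 2
    have hb0 := congrFun hb 0
    have hb1 := congrFun hb 1
    have hb2 := congrFun hb 2
    simp [hsA1, hsB1] at ha0 ha1 ha2 hb0 hb1 hb2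
    have hv0 : v 0 = 0 := by simpa using ha2.symm
    rw [ha0, hv0] at hb1
    rw [hv0] at ha1
    have hv1 : v 1 = 0 := by simpa using ha1.symm
    have hv3 : v 3 = 0 := by simpa using hb1.symm
    have hv2 : v 2 = 0 := by simpa using hb0.symm
    have hv4 : v 4 = 0 := by simpa using hb2.symm
    funext i
    fin_cases i <;> simp [hv0, hv1, hv2, hv3, hv4]
  · rw [hs_deg1, hs_deg0]
    rintro ⟨_, _⟩ ⟨⟨⟨a, rfl⟩, ⟨b, rfl⟩⟩, h⟩
    have h' : cocycleMap k t (hsP k t hsE1 a, hsP k t hsE1 b) = 0 := h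
    rw [hs_coc1] at h'
    have h2 := hs_inj2 k t (h'.trans (map_zero _).symm)
    have e0 := congrFun h2 0
    have e1 := congrFun h2 1
    have e2 := congrFun h2 2
    have e3 := congrFun h2 3
    have e4 := congrFun h2 4
    simp [smul_eq_C_mul, hs_C2, hs_C3] at e0 e1 e2 e3 e4
    obtain ⟨c, hc⟩ := hs_delta_const k (a 2) (sub_eq_zero.1 e4)
    obtain ⟨q, hq⟩ := hs_delta_const k (b 0) (sub_eq_zero.1 e0).symm
    obtain ⟨r, hr⟩ := hs_delta_const k (b 2) (sub_eq_zero.1 e3).symm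
    rw [hc] at e1 e2
    simp only [C_comp] at e1 e2
    obtain ⟨p, hp⟩ := hs_delta_const k (a 1 + C c * X) (by
      simp only [add_comp, mul_comp, C_comp, X_comp]; linear_combination e2)
    obtain ⟨s, hs⟩ := hs_delta_const k (b 1 - a 0 - C t * C c * X) (by
      simp only [sub_comp, mul_comp, C_comp, X_comp]; linear_combination -e1)
    obtain ⟨f, hf⟩ := hs_delta_surj k (-(a 0))
    refine ⟨![c, p, q, s, r], ?_⟩
    refine ⟨_, ⟨![f], rfl⟩, ?_⟩
    rw [hs_cob0]
    refine Prod.ext ?_ ?_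
    · change hsP k t hsE1 _ = hsP k t hsE1 a - hsP k t hsE1 (hsA1 k _)
      rw [← map_sub]
      congr 1
      funext i
      fin_cases i <;> simp [hsA1]
      · linear_combination -hf
      · linear_combination -hp
      · rw [hc]; ring
    · change hsP k t hsE1 _ = hsP k t hsE1 b - hsP k t hsE1 (hsB1 k t _)
      rw [← map_sub]
      congr 1
      funext i
      fin_cases i <;> simp [hsB1]
      · rw [hq]; ring
      · linear_combination -hf - hs
      · rw [hr]; ring

open Polynomial in
theorem hs_dim2 [CharZero k] : Module.finrank k
      (LinearMap.range ((Submodule.map (coboundaryMap k t) (deg1 k t)).mkQ.comp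
        (cocycles k t (deg2 k t)).subtype)) = 8 := by
  apply hs_finrank k 8 _ _
    (LinearMap.prod ((hsP k t hsE2).comp (hsA2 k)) ((hsP k t hsE2).comp (hsB2 k t)))
  · intro v
    rw [hs_deg2]
    refine (hs_coc_iff k t _ _ _).2 ?_
    rw [hs_coc2]
    convert map_zero (hsP k t hsE3) using 2
    funext i
    fin_cases i <;> simp [hsA2, hsB2, smul_eq_C_mul, hs_C2, hs_C3] <;> ring
  · rw [hs_deg1]
    rintro v ⟨_, ⟨f, rfl⟩, h⟩
    rw [hs_cob1] at h
    have ha := hs_inj2 k t (congrArg Prod.fst h)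
    have hb := hs_inj2 k t (congrArg Prod.snd h)
    have ha0 := congrFun ha 0
    have ha1 := congrFun ha 1
    have ha2 := congrFun ha 2
    have ha3 := congrFun ha 3
    have ha4 := congrFun ha 4
    have ha5 := congrFun ha 5
    have hb0 := congrFun hb 0
    have hb1 := congrFun hb 1
    have hb2 := congrFun hb 2
    have hb3 := congrFun hb 3
    have hb4 := congrFun hb 4
    have hb5 := congrFun hb 5
    simp [hsA2, hsB2, smul_eq_C_mul, hs_C2, hs_C3] at ha0 ha1 ha2 ha3 ha4 ha5 hb0 hb1 hb2 hb3 hb4 hb5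
    have hv0 : v 0 = 0 := by simpa using ha5.symm
    rw [hv0] at ha4
    have hv1 : v 1 = 0 := by simpa using ha4.symm
    rw [hv0, hv1] at ha2
    have hv2 : v 2 = 0 := by simpa using ha2.symm
    have hf2 : (f 2).comp (X + 1) = 0 := by
      rw [hv0, hv1, ha1] at hb2
      simpa using hb2
    rw [hv0, ha0, hf2] at hb1
    have hv4 : v 4 = 0 := by simpa using hb1.symm
    rw [hv0, ha3] at hb4
    have hv6 : v 6 = 0 := by simpa using hb4.symm
    have hv3 : v 3 = 0 := by simpa using hb0.symm
    have hv5 : v 5 = 0 := by simpa using hb3.symm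
    have hv7 : v 7 = 0 := by simpa using hb5.symm
    funext i
    fin_cases i <;> simp [hv0, hv1, hv2, hv3, hv4, hv5, hv6, hv7]
  · rw [hs_deg2, hs_deg1]
    rintro ⟨_, _⟩ ⟨⟨⟨a, rfl⟩, ⟨b, rfl⟩⟩, h⟩
    have h' : cocycleMap k t (hsP k t hsE2 a, hsP k t hsE2 b) = 0 := h
    rw [hs_coc2] at h'
    have h2 := hs_inj3 k t (h'.trans (map_zero _).symm)
    have e0 := congrFun h2 0
    have e1 := congrFun h2 1
    have e2 := congrFun h2 2
    have e3 := congrFun h2 3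
    have e4 := congrFun h2 4
    have e5 := congrFun h2 5
    have e6 := congrFun h2 6
    have e7 := congrFun h2 7
    have e8 := congrFun h2 8
    simp [smul_eq_C_mul, hs_C2, hs_C3] at e0 e1 e2 e3 e4 e5 e6 e7 e8
    obtain ⟨c, hc⟩ := hs_delta_const k (a 5) (sub_eq_zero.1 e8)
    obtain ⟨u0, hu0⟩ := hs_delta_const k (b 0) (sub_eq_zero.1 e0).symm
    obtain ⟨u3, hu3⟩ := hs_delta_const k (b 3) (sub_eq_zero.1 e4).symm
    obtain ⟨u5, hu5⟩ := hs_delta_const k (b 5) (sub_eq_zero.1 e7).symm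
    rw [hc] at e1 e2 e3 e5 e6
    simp only [C_comp] at e1 e2 e3 e5 e6
    obtain ⟨p, hp⟩ := hs_delta_const k (a 4 + 2 * C c * X) (by
      simp; linear_combination e6)
    have hp' : a 4 = C p - 2 * C c * X := by linear_combination hp
    rw [hp'] at e2 e3
    simp at e2 e3
    obtain ⟨q, hq⟩ := hs_delta_const k (a 2 - C c * (X * (X - 1)) + C p * X) (by
      simp; linear_combination e3)
    obtain ⟨h, hh⟩ := hs_delta_surj k (-(a 3))
    obtain ⟨f, hf⟩ := hs_delta_surj k (-(a 0))
    obtain ⟨g, hg⟩ := hs_delta_surj k (-(a 1))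
    obtain ⟨v6, h6⟩ := hs_delta_const k (b 4 - a 3 - 2 * C t * C c * X) (by
      simp; linear_combination -e5)
    have hh' := congrArg (fun r => r.comp (X + 1)) hh
    simp at hh'
    obtain ⟨w, hw⟩ := hs_delta_const k
      (b 2 - a 1 + h.comp (X + 1) -
        (-(C t * C c * (X * (X - 1))) + C t * C p * X + C t * C c * X)) (by
      simp; linear_combination -e2 + hh')
    obtain ⟨s, hs⟩ := hs_delta_const k
      (b 1 - a 0 + C t * (h.comp (X + 1) - C w) - C t * C t * C c * X) (by
      simp; linear_combination -e1 + C t * hh')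
    refine ⟨![c, p, q, u0, s, u3, v6, u5], ?_⟩
    refine ⟨_, ⟨![f, g, h - C w], rfl⟩, ?_⟩
    rw [hs_cob1]
    refine Prod.ext ?_ ?_
    · change hsP k t hsE2 _ = hsP k t hsE2 a - hsP k t hsE2 (hsA2 k _)
      rw [← map_sub]
      congr 1
      funext i
      fin_cases i <;> simp [hsA2]
      · linear_combination -hf
      · linear_combination -hg
      · linear_combination -hq
      · linear_combination -hh
      · linear_combination -hp
      · rw [hc]; ring
    · change hsP k t hsE2 _ = hsP k t hsE2 b - hsP k t hsE2 (hsB2 k t _)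
      rw [← map_sub]
      congr 1
      funext i
      fin_cases i <;> simp [hsB2, smul_eq_C_mul, hs_C2, hs_C3]
      · rw [hu0]; ring
      · linear_combination -hf - hs
      · linear_combination -hg - hw
      · rw [hu3]; ring
      · linear_combination -hh - h6
      · rw [hu5]; ring

/-- The homogeneous components of degrees `0` and `1` of the Hochschild cohomology
`H¹(S,U)` have dimensions `5` and `8` respectively:
`{(a,b) ∈ U₁×U₁ : [x,b]=[y,a]} / {([x,u],[y,u]) : u ∈ U₀}` has `k`-dimension `5` and
`{(a,b) ∈ U₂×U₂ : [x,b]=[y,a]} / {([x,u],[y,u]) : u ∈ U₁}` has `k`-dimension `8`. -/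
theorem H1SU_degree_zero_and_one_dims
    [CharZero k] (ht : t ≠ 0) :
    Module.finrank k
      (LinearMap.range ((Submodule.map (coboundaryMap k t) (deg0 k t)).mkQ.comp
        (cocycles k t (deg1 k t)).subtype)) = 5 ∧
    Module.finrank k
      (LinearMap.range ((Submodule.map (coboundaryMap k t) (deg1 k t)).mkQ.comp
        (cocycles k t (deg2 k t)).subtype)) = 8 := by
  exact ⟨hs_dim1 k t, hs_dim2 k t⟩
end

section
/- A k-linear derivation θ : S → S satisfies Q ∣ θ(Q) if and only if there exist f, g ∈ S with θ = f·E + g·D, and such f and g are unique; that is, the S-module Der(𝒜) = {θ ∈ Der_k(S) : Q divides θ(Q)} is free with basis (E, D). -/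
/-!
Let `k` be a field of characteristic zero, `t ∈ k`, `t ≠ 0`, `S = k[x,y]`, and
`Q = x·y·(tx+y)`, a defining polynomial of the central arrangement of the three lines
`x = 0`, `y = 0`, `tx + y = 0`.  Let `E = x∂ₓ + y∂_y` be the Euler derivation and
`D = y(tx+y)∂_y`.  Then a `k`-linear derivation `θ` of `S` satisfies `Q ∣ θ(Q)` iff
`θ = f•E + g•D` for unique `f, g ∈ S`; i.e. `Der 𝒜` is a free `S`-module with
basis `(E, D)`.
-/

open MvPolynomial

/-- The polynomial ring `S = k[x,y]`. -/
noncomputable abbrev S (k : Type) [Field k] : Type := MvPolynomial (Fin 2) k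

variable (k : Type) [Field k] (t : k)

/-- The Euler derivation `E = x ∂ₓ + y ∂_y` of `S`. -/
noncomputable def eulerE : Derivation k (S k) (S k) :=
  (X 0 : S k) • pderiv (R := k) (0 : Fin 2) + (X 1 : S k) • pderiv (R := k) (1 : Fin 2)

/-- The derivation `D = y (t x + y) ∂_y` of `S`. -/
noncomputable def derD : Derivation k (S k) (S k) :=
  ((X 1 : S k) * (t • (X 0 : S k) + X 1)) • pderiv (R := k) (1 : Fin 2)

/-- The defining polynomial `Q = x y (t x + y)` of the arrangement of three lines. -/
noncomputable def Qpoly : S k := (X 0 : S k) * X 1 * (t • (X 0 : S k) + X 1)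

theorem aux_cancel {R : Type*} [CommRing R] [IsDomain R] {p L m h : R} (hp : Prime p)
    (hL : ¬ p ∣ L) (e : L * m = p * h) : L ∣ h := by
  rcases hp.dvd_or_dvd (Dvd.intro h e.symm) with h1 | ⟨m', rfl⟩
  · exact absurd h1 hL
  · refine ⟨m', mul_left_cancel₀ hp.ne_zero ?_⟩
    rw [← e]; ring

/-- A `k`-linear derivation `θ : S → S` satisfies `Q ∣ θ(Q)` if and only if there exist
unique `f, g ∈ S` with `θ = f•E + g•D`: the `S`-module `Der 𝒜` of derivations tangent to
the arrangement is free with basis `(E, D)`. -/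
theorem derivations_tangent_free_basis
    [CharZero k] (ht : t ≠ 0) (θ : Derivation k (S k) (S k)) :
    (Qpoly k t ∣ θ (Qpoly k t)) ↔
      ∃! p : S k × S k, θ = p.1 • eulerE k + p.2 • derD k t := by
  have px : Prime (X 0 : S k) := X_prime
  have py : Prime (X 1 : S k) := X_prime
  have x_y : ¬ (X 0 : S k) ∣ X 1 := by simp [X_dvd_X]
  have y_x : ¬ (X 1 : S k) ∣ X 0 := by simp [X_dvd_X]
  have hE0 : eulerE k (X 0) = X 0 := by simp [eulerE, pderiv_X]
  have hE1 : eulerE k (X 1) = X 1 := by simp [eulerE, pderiv_X]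
  have hD0 : derD k t (X 0) = 0 := by simp [derD, pderiv_X]
  have hD1 : derD k t (X 1) = X 1 * (t • (X 0 : S k) + X 1) := by simp [derD, pderiv_X]
  have hQ : θ (Qpoly k t) = θ (X 0) * X 1 * (t • (X 0 : S k) + X 1)
      + X 0 * θ (X 1) * (t • (X 0 : S k) + X 1) + X 0 * X 1 * (t • θ (X 0) + θ (X 1)) := by
    simp only [Qpoly, Derivation.leibniz, map_add, Derivation.map_smul, smul_eq_mul]
    ring
  have key : ∀ p : S k × S k, θ = p.1 • eulerE k + p.2 • derD k t ↔
      (θ (X 0) = p.1 * X 0 ∧ θ (X 1) = p.1 * X 1 + p.2 * (X 1 * (t • (X 0 : S k) + X 1))) := by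
    intro p
    constructor
    · intro h
      constructor
      · rw [h]; simp [hE0, hD0]
      · rw [h]; simp [hE1, hD1]
    · rintro ⟨h0, h1⟩
      apply MvPolynomial.derivation_ext
      intro i
      fin_cases i
      · simpa [hE0, hD0] using h0
      · simpa [hE1, hD1] using h1
  have x_L : ¬ (X 0 : S k) ∣ t • (X 0 : S k) + X 1 := by
    intro h
    rw [smul_eq_C_mul] at h
    exact x_y ((dvd_add_right (Dvd.intro_left _ rfl)).1 h)
  have y_L : ¬ (X 1 : S k) ∣ t • (X 0 : S k) + X 1 := by
    intro h
    have h2 : (X 1 : S k) ∣ t • (X 0 : S k) := (dvd_add_left dvd_rfl).1 h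
    apply y_x
    have h3 : (X 0 : S k) = C t⁻¹ * (t • (X 0 : S k)) := by
      rw [smul_eq_C_mul, ← mul_assoc, ← C_mul, inv_mul_cancel₀ ht, C_1, one_mul]
    rw [h3]
    exact h2.mul_left _
  simp only [key]
  rw [hQ, Qpoly]
  simp only [smul_eq_C_mul] at *
  generalize θ (X 0) = a at *
  generalize θ (X 1) = b at *
  generalize (C t : S k) = T at *
  have hL0 : T * X 0 + X 1 ≠ 0 := fun h => x_L (h ▸ dvd_zero _)
  constructor
  · rintro ⟨c, hc⟩
    obtain ⟨f, rfl⟩ : (X 0 : S k) ∣ a := by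
      have : (X 0 : S k) ∣ a * X 1 * (T * X 0 + X 1) :=
        ⟨X 1 * (T * X 0 + X 1) * c - b * (T * X 0 + X 1) - X 1 * (T * a + b), by
          linear_combination hc⟩
      rcases px.dvd_or_dvd this with h | h
      · exact (px.dvd_or_dvd h).resolve_right x_y
      · exact absurd h x_L
    obtain ⟨b, rfl⟩ : (X 1 : S k) ∣ b := by
      have : (X 1 : S k) ∣ X 0 * b * (T * X 0 + X 1) :=
        ⟨X 0 * (T * X 0 + X 1) * c - X 0 * f * (T * X 0 + X 1) - X 0 * (T * (X 0 * f) + b), by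
          linear_combination hc⟩
      rcases py.dvd_or_dvd this with h | h
      · exact (py.dvd_or_dvd h).resolve_left y_x
      · exact absurd h y_L
    obtain ⟨g, hg⟩ : T * X 0 + X 1 ∣ b - f := by
      refine aux_cancel py y_L (m := c - 2 * f - b) ?_
      apply mul_left_cancel₀ (mul_ne_zero px.ne_zero py.ne_zero)
      linear_combination -hc
    refine ⟨(f, g), ⟨by ring, by linear_combination X 1 * hg⟩, ?_⟩
    rintro ⟨f', g'⟩ ⟨h0, h1⟩
    simp only at h0 h1
    have hf : f' = f := mul_left_cancel₀ px.ne_zero (by linear_combination -h0)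
    subst hf
    have hg' : g' = g := mul_left_cancel₀ (mul_ne_zero py.ne_zero hL0)
      (by linear_combination -h1 + X 1 * hg)
    rw [hg']
  · rintro ⟨⟨f, g⟩, ⟨h0, h1⟩, -⟩
    simp only at h0 h1
    subst h0 h1
    exact ⟨3 * f + g * (T * X 0 + X 1) + g * X 1, by ring⟩
end

section
/- Let N be a left U-module equipped with a direct sum decomposition N = ⊕_{i∈ℤ} N_i into k-subspaces such that E·n = i·n for every i ∈ ℤ and n ∈ N_i (N is eulerian). Then D·N₀ ⊆ N₁; write ∇_D : N₀ → N₁ for the restriction of the action of D. Define k-linear maps d⁰ : N → N × N by d⁰(n) = (D·n, E·n) and d¹ : N × N → N by d¹(n,m) = D·m − E·n + n. Then d¹∘d⁰ = 0 and there are isomorphisms of k-vector spaces: ker d⁰ ≅ ker ∇_D; (ker d¹)/(range d⁰) ≅ (N₁/range ∇_D) × ker ∇_D; and N/(range d¹) ≅ N₁/(range ∇_D). -/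
variable (k : Type) [Field k] (t : k)

variable {k t} (N : Type) [AddCommGroup N] [Module k N] [Module (DiffA k t) N]
  [IsScalarTower k (DiffA k t) N]

/-- The `k`-linear endomorphism of a `U`-module given by the action of `u ∈ U`. -/
noncomputable def actionMap (u : DiffA k t) : N →ₗ[k] N where
  toFun n := u • n
  map_add' := smul_add u
  map_smul' c n := by
    simp only [RingHom.id_apply]
    rw [← IsScalarTower.algebraMap_smul (DiffA k t) c n, ← mul_smul, ← Algebra.commutes,
      mul_smul, IsScalarTower.algebraMap_smul]

variable (k t)

/-- The map `d⁰ : N → N × N`, `d⁰(n) = (D·n, E·n)`. -/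
noncomputable def d0 : N →ₗ[k] N × N :=
  (actionMap N (genD k t)).prod (actionMap N (genE k t))

/-- The map `d¹ : N × N → N`, `d¹(n, m) = D·m − E·n + n`. -/
noncomputable def d1 : N × N →ₗ[k] N :=
  (actionMap N (genD k t)).comp (LinearMap.snd k N N) -
    (actionMap N (genE k t)).comp (LinearMap.fst k N N) + LinearMap.fst k N N

variable {k t}

theorem aux_S {k N : Type} [Field k] [AddCommGroup N] [Module k N]
    (𝒩 : ℤ → Submodule k N) (hdec : DirectSum.IsInternal 𝒩) :
    ∃ S : (ℤ → k) → (N →ₗ[k] N), (∀ f i, ∀ n ∈ 𝒩 i, S f n = f i • n) ∧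
      (∀ j n, S (Pi.single j 1) n ∈ 𝒩 j) := by
  classical
  letI := hdec.chooseDecomposition
  have key : ∀ (f : ℤ → k) (i : ℤ), ∀ n ∈ 𝒩 i,
      ((DirectSum.toModule k ℤ N (fun i => f i • (𝒩 i).subtype)) ∘ₗ
        (DirectSum.decomposeLinearEquiv 𝒩).toLinearMap) n = f i • n := by
    intro f i n hn
    simp only [LinearMap.comp_apply, LinearEquiv.coe_coe, DirectSum.decomposeLinearEquiv_apply]
    rw [DirectSum.decompose_of_mem 𝒩 hn]
    erw [DirectSum.toModule_lof]
    simp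
  refine ⟨fun f => (DirectSum.toModule k ℤ N (fun i => f i • (𝒩 i).subtype)) ∘ₗ
    (DirectSum.decomposeLinearEquiv 𝒩).toLinearMap, key, ?_⟩
  intro j n
  induction n using DirectSum.Decomposition.inductionOn 𝒩 with
  | zero => rw [map_zero]; exact zero_mem _
  | @homogeneous i m =>
    rw [key _ i m m.2]
    by_cases h : i = j
    · subst h; simp
    · simp [Pi.single_eq_of_ne h]
  | add m m' h h' => rw [map_add]; exact add_mem h h'

theorem aux_ext {k N : Type} [Field k] [AddCommGroup N] [Module k N]
    (𝒩 : ℤ → Submodule k N) (hdec : DirectSum.IsInternal 𝒩) (f g : N →ₗ[k] N)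
    (h : ∀ i, ∀ n ∈ 𝒩 i, f n = g n) (n : N) : f n = g n := by
  classical
  letI := hdec.chooseDecomposition
  induction n using DirectSum.Decomposition.inductionOn 𝒩 with
  | zero => simp
  | @homogeneous i m => exact h i m m.2
  | add m m' h h' => rw [map_add, map_add, h, h']

theorem aux_main {k N : Type} [Field k] [CharZero k] [AddCommGroup N] [Module k N]
    (D E : N →ₗ[k] N) (hED : ∀ n, E (D n) = D (E n) + D n)
    (d0 : N →ₗ[k] N × N) (hd0 : ∀ n, d0 n = (D n, E n))
    (d1 : N × N →ₗ[k] N) (hd1 : ∀ p, d1 p = D p.2 - E p.1 + p.1)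
    (𝒩 : ℤ → Submodule k N) (hdec : DirectSum.IsInternal 𝒩)
    (heuler : ∀ (i : ℤ), ∀ n ∈ 𝒩 i, E n = (i : k) • n) :
    ∃ hD : ∀ n ∈ 𝒩 0, D n ∈ 𝒩 1,
      d1.comp d0 = 0 ∧
      Nonempty (↥(LinearMap.ker d0) ≃ₗ[k] ↥(LinearMap.ker (D.restrict hD))) ∧
      Nonempty
        ((↥(LinearMap.ker d1) ⧸
            Submodule.comap (LinearMap.ker d1).subtype (LinearMap.range d0)) ≃ₗ[k]
          (↥(𝒩 1) ⧸ LinearMap.range (D.restrict hD)) × ↥(LinearMap.ker (D.restrict hD))) ∧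
      Nonempty
        ((N ⧸ LinearMap.range d1) ≃ₗ[k] ↥(𝒩 1) ⧸ LinearMap.range (D.restrict hD)) := by
  obtain ⟨S, hS, hSm⟩ := aux_S 𝒩 hdec
  have ext := aux_ext 𝒩 hdec
  -- eigenvectors are homogeneous
  have eig : ∀ (j : ℤ) n, E n = (j : k) • n → n ∈ 𝒩 j := by
    intro j n hn
    have h := ext (S (fun i => ((i : k) - j)⁻¹) ∘ₗ (E - (j : k) • LinearMap.id))
      (LinearMap.id - S (Pi.single j 1)) (by
        intro i m hm
        simp only [LinearMap.comp_apply, LinearMap.sub_apply, LinearMap.smul_apply,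
          LinearMap.id_apply, heuler i m hm, ← sub_smul, map_smul, hS _ i m hm]
        by_cases hij : i = j
        · subst hij; simp
        · have : (i : k) - j ≠ 0 := sub_ne_zero.2 (by exact_mod_cast hij)
          simp [Pi.single_eq_of_ne hij, smul_smul, this]) n
    simp only [LinearMap.comp_apply, LinearMap.sub_apply, LinearMap.smul_apply,
          LinearMap.id_apply, hn, sub_self, map_zero] at h
    rw [sub_eq_zero.1 h.symm]
    exact hSm j n
  have hDi : ∀ (i : ℤ), ∀ n ∈ 𝒩 i, D n ∈ 𝒩 (i + 1) := by
    intro i n hn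
    apply eig
    rw [hED, heuler i n hn, map_smul]
    push_cast
    rw [add_smul, one_smul]
  have hD : ∀ n ∈ 𝒩 0, D n ∈ 𝒩 1 := fun n hn => by simpa using hDi 0 n hn
  have hE0 : ∀ n ∈ 𝒩 0, E n = 0 := fun n hn => by simpa using heuler 0 n hn
  have hE1 : ∀ n ∈ 𝒩 1, E n = n := fun n hn => by simpa using heuler 1 n hn
  obtain ⟨P0, hP0⟩ : ∃ P0 : N →ₗ[k] 𝒩 0, ∀ n, (P0 n : N) = S (Pi.single 0 1) n :=
    ⟨(S (Pi.single 0 1)).codRestrict _ (hSm 0), fun n => rfl⟩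
  obtain ⟨P1, hP1⟩ : ∃ P1 : N →ₗ[k] 𝒩 1, ∀ n, (P1 n : N) = S (Pi.single 1 1) n :=
    ⟨(S (Pi.single 1 1)).codRestrict _ (hSm 1), fun n => rfl⟩
  have hP0id : ∀ n : 𝒩 0, P0 n = n := fun n => Subtype.ext (by rw [hP0, hS _ 0 n n.2]; simp)
  have hP1id : ∀ n : 𝒩 1, P1 n = n := fun n => Subtype.ext (by rw [hP1, hS _ 1 n n.2]; simp)
  obtain ⟨h, hh⟩ : ∃ h, h = S (fun i => (i : k)⁻¹) := ⟨_, rfl⟩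
  obtain ⟨h', hh'⟩ : ∃ h, h = S (fun i => ((i : k) - 1)⁻¹) := ⟨_, rfl⟩
  have hDP : ∀ n, (P1 (D n) : N) = D (P0 n) := by
    intro n
    rw [hP0, hP1]
    refine ext (S (Pi.single 1 1) ∘ₗ D) (D ∘ₗ S (Pi.single 0 1)) ?_ n
    intro i m hm
    simp only [LinearMap.comp_apply]
    rw [hS _ _ _ (hDi i m hm), hS _ _ _ hm, map_smul]
    by_cases hi : i = 0
    · subst hi; simp
    · rw [Pi.single_eq_of_ne hi, Pi.single_eq_of_ne (by omega)]
  have hDh : ∀ n, D (h n) = h' (D n) := by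
    intro n
    rw [hh, hh']
    refine ext (D ∘ₗ S _) (S _ ∘ₗ D) ?_ n
    intro i m hm
    simp only [LinearMap.comp_apply]
    rw [hS _ _ _ (hDi i m hm), hS _ _ _ hm, map_smul]
    simp
  have hEh : ∀ n, E (h n) = n - P0 n := by
    intro n
    rw [hh, hP0]
    refine ext (E ∘ₗ S _) (LinearMap.id - S _) ?_ n
    intro i m hm
    simp only [LinearMap.comp_apply, LinearMap.sub_apply, LinearMap.id_apply]
    rw [hS _ _ _ hm, hS _ _ _ hm, map_smul, heuler i m hm]
    by_cases hi : i = 0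
    · subst hi; simp
    · have : (i : k) ≠ 0 := by exact_mod_cast hi
      simp [Pi.single_eq_of_ne hi, smul_smul, this]
  have hEh' : ∀ n, E (h' n) - h' n = n - P1 n := by
    intro n
    rw [hh', hP1]
    refine ext (E ∘ₗ S _ - S _) (LinearMap.id - S _) ?_ n
    intro i m hm
    simp only [LinearMap.comp_apply, LinearMap.sub_apply, LinearMap.id_apply]
    rw [hS _ _ _ hm, hS _ _ _ hm, map_smul, heuler i m hm]
    by_cases hi : i = 1
    · subst hi; simp
    · have : (i : k) - 1 ≠ 0 := sub_ne_zero.2 (by exact_mod_cast hi)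
      rw [← smul_sub, show (i : k) • m - m = ((i : k) - 1) • m by rw [sub_smul, one_smul], smul_smul]
      simp [Pi.single_eq_of_ne hi, this]
  have hh'E : ∀ n, h' (E n - n) = n - P1 n := by
    intro n
    rw [← hEh', map_sub]
    congr 1
    rw [hh']
    refine ext (S _ ∘ₗ E) (E ∘ₗ S _) ?_ n
    intro i m hm
    simp only [LinearMap.comp_apply]
    rw [hS _ _ _ hm, map_smul, heuler i m hm, map_smul, hS _ _ _ hm, smul_comm]
  have hP0E : ∀ n, P0 (E n) = 0 := by
    intro n
    apply Subtype.ext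
    rw [hP0]
    refine ext (S _ ∘ₗ E) 0 ?_ n
    intro i m hm
    simp only [LinearMap.comp_apply, LinearMap.zero_apply]
    rw [heuler i m hm, map_smul, hS _ _ _ hm]
    by_cases hi : i = 0
    · subst hi; simp
    · simp [Pi.single_eq_of_ne hi]
  have hP1E : ∀ n, P1 (E n) = P1 n := by
    intro n
    apply Subtype.ext
    rw [hP1, hP1]
    refine ext (S _ ∘ₗ E) (S _) ?_ n
    intro i m hm
    simp only [LinearMap.comp_apply]
    rw [heuler i m hm, map_smul, hS _ _ _ hm]
    by_cases hi : i = 1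
    · subst hi; simp
    · simp [Pi.single_eq_of_ne hi]
  have hq : ∀ v : 𝒩 1, (LinearMap.range (D.restrict hD)).mkQ v = 0 ↔
      ∃ w ∈ 𝒩 0, D w = v := by
    intro v
    rw [Submodule.mkQ_apply, Submodule.Quotient.mk_eq_zero, LinearMap.mem_range]
    constructor
    · rintro ⟨w, rfl⟩; exact ⟨w, w.2, rfl⟩
    · rintro ⟨w, hw, e⟩; exact ⟨⟨w, hw⟩, Subtype.ext e⟩
  have hk : ∀ v : 𝒩 0, v ∈ LinearMap.ker (D.restrict hD) ↔ D v = 0 := by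
    intro v
    rw [LinearMap.mem_ker, ← Subtype.coe_inj]; rfl
  refine ⟨hD, ?_, ?_, ?_, ?_⟩
  · ext n
    simp [hd0, hd1, hED]
  · have m0 : ∀ n, n ∈ LinearMap.ker d0 ↔ D n = 0 ∧ E n = 0 := by
      intro n; rw [LinearMap.mem_ker, hd0, Prod.mk_eq_zero]
    exact ⟨{
      toFun := fun n => ⟨⟨n, eig 0 n (by simpa using ((m0 n).1 n.2).2)⟩,
        (hk _).2 ((m0 n).1 n.2).1⟩
      invFun := fun n => ⟨n.1.1, (m0 _).2 ⟨(hk _).1 n.2, hE0 _ n.1.2⟩⟩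
      left_inv := fun n => rfl
      right_inv := fun n => rfl
      map_add' := fun _ _ => rfl
      map_smul' := fun _ _ => rfl }⟩
  · have mk1 : ∀ p, p ∈ LinearMap.ker d1 ↔ D p.2 = E p.1 - p.1 := by
      intro p
      rw [LinearMap.mem_ker, hd1, sub_add, sub_eq_zero]
    let A : LinearMap.ker d1 →ₗ[k] (↥(𝒩 1) ⧸ LinearMap.range (D.restrict hD)) :=
      (LinearMap.range (D.restrict hD)).mkQ ∘ₗ P1 ∘ₗ LinearMap.fst k N N ∘ₗ
        (LinearMap.ker d1).subtype
    let B : LinearMap.ker d1 →ₗ[k] ↥(LinearMap.ker (D.restrict hD)) :=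
      (P0 ∘ₗ LinearMap.snd k N N ∘ₗ (LinearMap.ker d1).subtype).codRestrict _ (by
        intro p
        rw [hk]
        change D (P0 p.1.2) = 0
        rw [← hDP, (mk1 _).1 p.2, map_sub, hP1E, sub_self]; rfl)
    have hA : ∀ p, A p = (LinearMap.range (D.restrict hD)).mkQ (P1 p.1.1) := fun _ => rfl
    have hB : ∀ p, ((B p : 𝒩 0)) = P0 p.1.2 := fun _ => rfl
    have hsurj : Function.Surjective (A.prod B) := by
      rintro ⟨a, b⟩
      obtain ⟨v, rfl⟩ := Submodule.mkQ_surjective _ a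
      refine ⟨⟨(v, b.1), (mk1 _).2 ?_⟩, ?_⟩
      · change D b.1 = E v - v
        rw [hE1 v v.2, sub_self]
        exact (hk _).1 b.2
      · apply Prod.ext
        · change A _ = _
          rw [hA]; simp only [hP1id]
        · change B _ = _
          apply Subtype.ext
          rw [hB]; simp only [hP0id]
    have hker : Submodule.comap (LinearMap.ker d1).subtype (LinearMap.range d0)
        = LinearMap.ker (A.prod B) := by
      ext p
      rw [Submodule.mem_comap, LinearMap.mem_range, LinearMap.mem_ker,
        show (A.prod B) p = (A p, B p) from rfl, Prod.mk_eq_zero, hA, hq, ← Subtype.coe_inj, hB]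
      constructor
      · rintro ⟨n, hn⟩
        rw [hd0] at hn
        have e1 : D n = p.1.1 := congrArg Prod.fst hn
        have e2 : E n = p.1.2 := congrArg Prod.snd hn
        rw [← e1, ← e2]
        exact ⟨⟨P0 n, (P0 n).2, (hDP n).symm⟩, hP0E n⟩
      · rintro ⟨⟨w, hw, e⟩, e0⟩
        refine ⟨h p.1.2 + w, ?_⟩
        rw [hd0]
        apply Prod.ext
        · change D (h p.1.2 + w) = p.1.1
          rw [map_add, hDh, e, (mk1 _).1 p.2, hh'E, sub_add_cancel]
        · change E (h p.1.2 + w) = p.1.2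
          rw [map_add, hEh, e0, hE0 w hw]
          simp
    exact ⟨(Submodule.quotEquivOfEq _ _ hker).trans
      (LinearMap.quotKerEquivOfSurjective _ hsurj)⟩
  · have hsurj : Function.Surjective ((LinearMap.range (D.restrict hD)).mkQ ∘ₗ P1) := by
      intro a
      obtain ⟨v, rfl⟩ := Submodule.mkQ_surjective _ a
      exact ⟨v, by rw [LinearMap.comp_apply, hP1id]⟩
    have hker : LinearMap.range d1
        = LinearMap.ker ((LinearMap.range (D.restrict hD)).mkQ ∘ₗ P1) := by
      ext n
      rw [LinearMap.mem_range, LinearMap.mem_ker, LinearMap.comp_apply, hq]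
      constructor
      · rintro ⟨p, rfl⟩
        refine ⟨P0 p.2, (P0 p.2).2, ?_⟩
        rw [hd1, map_add, map_sub, hP1E, sub_add_cancel, hDP]
      · rintro ⟨w, hw, e⟩
        refine ⟨(-h' n, w), ?_⟩
        rw [hd1]
        change D w - E (-h' n) + -h' n = n
        have := hEh' n
        rw [e, map_neg, sub_neg_eq_add, add_assoc, ← sub_eq_add_neg, this]
        abel
    exact ⟨(Submodule.quotEquivOfEq _ _ hker).trans
      (LinearMap.quotKerEquivOfSurjective _ hsurj)⟩

theorem aux_rel (k : Type) [Field k] (t : k) :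
    genE k t * genD k t = genD k t * genE k t + genD k t := by
  unfold genE genD
  rw [← map_mul, RingQuot.mkAlgHom_rel k (DiffRel.ED (k := k) (t := t)), map_add, map_mul]

/-- For an eulerian module `N = ⊕ᵢ Nᵢ` over `U = Diff 𝒜` one has `D·N₀ ⊆ N₁`, and, writing
`∇_D : N₀ → N₁` for the restriction of the action of `D`, the maps `d⁰(n) = (D·n, E·n)`
and `d¹(n,m) = D·m − E·n + n` satisfy `d¹ ∘ d⁰ = 0`, `ker d⁰ ≅ ker ∇_D`,
`(ker d¹)/(range d⁰) ≅ (N₁/range ∇_D) × ker ∇_D` and `N/(range d¹) ≅ N₁/(range ∇_D)`. -/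
theorem eulerian_module_complex
    [CharZero k] (ht : t ≠ 0)
    (𝒩 : ℤ → Submodule k N) (hdec : DirectSum.IsInternal 𝒩)
    (heuler : ∀ (i : ℤ), ∀ n ∈ 𝒩 i, genE k t • n = i • n) :
    ∃ hD : ∀ n ∈ 𝒩 0, actionMap N (genD k t) n ∈ 𝒩 1,
      (d1 k t N).comp (d0 k t N) = 0 ∧
      Nonempty (↥(LinearMap.ker (d0 k t N)) ≃ₗ[k]
        ↥(LinearMap.ker ((actionMap N (genD k t)).restrict hD))) ∧
      Nonempty
        ((↥(LinearMap.ker (d1 k t N)) ⧸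
            Submodule.comap (LinearMap.ker (d1 k t N)).subtype (LinearMap.range (d0 k t N))) ≃ₗ[k]
          (↥(𝒩 1) ⧸ LinearMap.range ((actionMap N (genD k t)).restrict hD)) ×
            ↥(LinearMap.ker ((actionMap N (genD k t)).restrict hD))) ∧
      Nonempty
        ((N ⧸ LinearMap.range (d1 k t N)) ≃ₗ[k]
          ↥(𝒩 1) ⧸ LinearMap.range ((actionMap N (genD k t)).restrict hD)) := by
  refine aux_main (actionMap N (genD k t)) (actionMap N (genE k t)) ?_
    (d0 k t N) (fun _ => rfl) (d1 k t N) (fun _ => rfl) 𝒩 hdec ?_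
  · intro n
    change genE k t • genD k t • n = genD k t • genE k t • n + genD k t • n
    rw [← mul_smul, aux_rel, add_smul, mul_smul]
  · intro i n hn
    change genE k t • n = _
    rw [heuler i n hn, Int.cast_smul_eq_zsmul]
end

section
/- An element u ∈ A_h commutes with x̄ if and only if u belongs to the subalgebra of A_h generated by x̄; that is, the centralizer of x̄ in A_h is the image of k[x] in A_h. -/
/-!
Let `k` be a field of characteristic zero, `h ∈ k[x]` nonzero, and `A_h` the quotient of
the free algebra `k⟨x,y⟩` by the two-sided ideal generated by `yx − xy − h(x)`.  An
element of `A_h` commutes with `x̄` iff it lies in the image of `k[x]` in `A_h`.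
-/

/-- The relation presenting `A_h`: `y·x = x·y + h(x)`, with `x = ι 0`, `y = ι 1`. -/
inductive AhRel (k : Type) [Field k] (h : Polynomial k) :
    FreeAlgebra k (Fin 2) → FreeAlgebra k (Fin 2) → Prop
  | rel : AhRel k h (FreeAlgebra.ι k 1 * FreeAlgebra.ι k 0)
      (FreeAlgebra.ι k 0 * FreeAlgebra.ι k 1 + Polynomial.aeval (FreeAlgebra.ι k 0) h)

/-- The algebra `A_h = k⟨x,y⟩/(yx − xy − h(x))`. -/
abbrev Ah (k : Type) [Field k] (h : Polynomial k) : Type := RingQuot (AhRel k h)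

variable (k : Type) [Field k] (h : Polynomial k)

/-- The image `x̄` of `x` in `A_h`. -/
noncomputable def ahX : Ah k h := RingQuot.mkAlgHom k (AhRel k h) (FreeAlgebra.ι k 0)

namespace AhAux
open Polynomial

noncomputable def ahY : Ah k h := RingQuot.mkAlgHom k (AhRel k h) (FreeAlgebra.ι k 1)

lemma ah_rel : ahY k h * ahX k h = ahX k h * ahY k h + aeval (ahX k h) h := by
  have := RingQuot.mkAlgHom_rel k (AhRel.rel (k := k) (h := h))
  rw [map_mul, map_add, map_mul, ← aeval_algHom_apply] at this
  exact this

/-- multiplication by a polynomial on the normal-form module -/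
noncomputable def mulP (p : k[X]) : (ℕ →₀ k[X]) →ₗ[k] (ℕ →₀ k[X]) :=
  Finsupp.mapRange.linearMap (LinearMap.mulLeft k p)

noncomputable def del : k[X] →ₗ[k] k[X] := (LinearMap.mulLeft k h) ∘ₗ derivative

noncomputable def T : (ℕ →₀ k[X]) →ₗ[k] (ℕ →₀ k[X]) :=
  Finsupp.lmapDomain _ k Nat.succ + Finsupp.mapRange.linearMap (del k h)

lemma mulP_apply (p : k[X]) (f : ℕ →₀ k[X]) (n : ℕ) : mulP k p f n = p * f n := by
  simp [mulP]

lemma T_zero (f : ℕ →₀ k[X]) : T k h f 0 = h * derivative (f 0) := by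
  simp [T, del, Finsupp.mapDomain_of_notMem_range]

lemma T_succ (f : ℕ →₀ k[X]) (n : ℕ) : T k h f (n+1) = f n + h * derivative (f (n+1)) := by
  have := Finsupp.mapDomain_apply Nat.succ_injective f n
  simp only [Nat.succ_eq_add_one] at this
  simp [T, del, this]

noncomputable def mulPHom : k[X] →ₐ[k] Module.End k (ℕ →₀ k[X]) :=
  AlgHom.ofLinearMap
    { toFun := mulP k
      map_add' := fun p q => by
        refine LinearMap.ext fun f => Finsupp.ext fun n => ?_
        simp [mulP_apply, add_mul, LinearMap.add_apply]
      map_smul' := fun c p => by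
        refine LinearMap.ext fun f => Finsupp.ext fun n => ?_
        simp [mulP_apply, LinearMap.smul_apply] }
    (by
      refine LinearMap.ext fun f => Finsupp.ext fun n => ?_
      simp [mulP_apply])
    (fun p q => by
      refine LinearMap.ext fun f => Finsupp.ext fun n => ?_
      simp [mulP_apply, mul_assoc])

lemma aeval_mulP (p : k[X]) : aeval (mulP k X : Module.End k _) p = mulP k p := by
  have := aeval_algHom_apply (mulPHom k) X p
  rw [aeval_X_left_apply] at this
  exact this

noncomputable def rho : Ah k h →ₐ[k] Module.End k (ℕ →₀ k[X]) :=
  RingQuot.liftAlgHom k ⟨FreeAlgebra.lift k ![mulP k X, T k h], by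
    rintro _ _ ⟨⟩
    simp only [map_mul, map_add, ← aeval_algHom_apply, FreeAlgebra.lift_ι_apply]
    simp only [Matrix.cons_val_zero, Matrix.cons_val_one]
    rw [aeval_mulP]
    refine LinearMap.ext fun f => Finsupp.ext fun n => ?_
    cases n <;> simp [mulP_apply, T_zero, T_succ] <;> ring⟩

lemma rho_x : rho k h (ahX k h) = mulP k X := by
  simp [rho, ahX]

lemma rho_y : rho k h (ahY k h) = T k h := by
  simp [rho, ahY]

noncomputable def N : (ℕ →₀ k[X]) →ₗ[k] Ah k h :=
  Finsupp.lsum k fun i =>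
    (LinearMap.mulRight k (ahY k h ^ i)) ∘ₗ (aeval (ahX k h)).toLinearMap

lemma N_single (i : ℕ) (p : k[X]) :
    N k h (Finsupp.single i p) = aeval (ahX k h) p * ahY k h ^ i := by
  simp [N]

lemma y_comm (p : k[X]) : ahY k h * aeval (ahX k h) p =
    aeval (ahX k h) p * ahY k h + aeval (ahX k h) (h * derivative p) := by
  induction p using Polynomial.induction_on with
  | C a => simp [Algebra.commutes]
  | add p q hp hq => simp only [map_add, mul_add, add_mul, hp, hq]; abel
  | monomial n a ih =>
    have e : (C a * X ^ (n+1) : k[X]) = (C a * X ^ n) * X := by ring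
    rw [e]
    generalize (C a * X ^ n : k[X]) = q at ih
    have e2 : h * derivative (q * X) = q * h + h * derivative q * X := by
      rw [derivative_mul, derivative_X]; ring
    rw [e2, map_add, map_mul _ q X, map_mul _ q h, map_mul _ _ X, aeval_X, ← mul_assoc, ih,
      add_mul, mul_assoc, ah_rel, mul_add, mul_assoc]
    abel

lemma N_x (f : ℕ →₀ k[X]) : ahX k h * N k h f = N k h (mulP k X f) := by
  induction f using Finsupp.induction_linear with
  | zero => simp
  | add f g hf hg => simp only [map_add, mul_add, hf, hg]
  | single i p =>
    rw [mulP, Finsupp.mapRange.linearMap_apply, Finsupp.mapRange_single, N_single, N_single,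
      LinearMap.mulLeft_apply, map_mul, aeval_X, mul_assoc]

lemma N_y (f : ℕ →₀ k[X]) : ahY k h * N k h f = N k h (T k h f) := by
  induction f using Finsupp.induction_linear with
  | zero => simp
  | add f g hf hg => simp only [map_add, mul_add, hf, hg]
  | single i p =>
    simp only [T, LinearMap.add_apply, Finsupp.lmapDomain_apply, Finsupp.mapDomain_single,
      Finsupp.mapRange.linearMap_apply, Finsupp.mapRange_single, map_add, N_single]
    rw [← mul_assoc, y_comm, add_mul, mul_assoc, ← pow_succ']
    rfl

lemma N_rho (u : Ah k h) : ∀ f, u * N k h f = N k h (rho k h u f) := by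
  obtain ⟨a, rfl⟩ := RingQuot.mkAlgHom_surjective k (AhRel k h) u
  induction a using FreeAlgebra.induction with
  | grade0 r => intro f; simp [Algebra.algebraMap_eq_smul_one]
  | grade1 i =>
    intro f
    fin_cases i
    · have := N_x k h f
      rw [← rho_x k h] at this
      exact this
    · have := N_y k h f
      rw [← rho_y k h] at this
      exact this
  | mul a b ha hb => intro f; simp only [map_mul, mul_assoc, hb, ha, Module.End.mul_apply]
  | add a b ha hb => intro f; simp only [map_add, add_mul, hb, ha, LinearMap.add_apply]

lemma T_pow (n : ℕ) :
    (∀ m, n < m → (T k h ^ n) (Finsupp.single 0 X) m = 0) ∧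
    (T k h ^ n) (Finsupp.single 0 X) n = X ∧
    (T k h ^ (n+1)) (Finsupp.single 0 X) n = ((n+1 : ℕ) : k[X]) * h := by
  induction n with
  | zero =>
    refine ⟨fun m hm => ?_, by simp, by simp [T_zero]⟩
    simp [Finsupp.single_apply, hm.ne]
  | succ n ih =>
    obtain ⟨h1, h2, h3⟩ := ih
    have h4 : ∀ m, n + 1 < m → (T k h ^ (n+1)) (Finsupp.single 0 X) m = 0 := by
      intro m hm
      obtain ⟨m, rfl⟩ : ∃ j, m = j + 1 := ⟨m - 1, by omega⟩
      rw [pow_succ', Module.End.mul_apply, T_succ, h1 _ (by omega), h1 _ (by omega)]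
      simp
    have h5 : (T k h ^ (n+1)) (Finsupp.single 0 X) (n+1) = X := by
      rw [pow_succ', Module.End.mul_apply, T_succ, h2, h1 _ (by omega)]
      simp
    refine ⟨h4, h5, ?_⟩
    rw [pow_succ', Module.End.mul_apply, T_succ, h3, h5]
    simp
    ring

lemma rho_N (f v : ℕ →₀ k[X]) (m : ℕ) :
    rho k h (N k h f) v m = f.sum fun i p => p * (T k h ^ i) v m := by
  induction f using Finsupp.induction_linear with
  | zero => simp
  | add f g hf hg =>
    rw [Finsupp.sum_add_index' (by simp) (by intros; ring), ← hf, ← hg]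
    simp
  | single i p =>
    rw [Finsupp.sum_single_index (by simp), N_single, map_mul, map_pow, rho_y,
      ← aeval_algHom_apply, rho_x, aeval_mulP, Module.End.mul_apply, mulP_apply]

end AhAux

/-- An element `u ∈ A_h` commutes with `x̄` if and only if `u` belongs to the image of
`k[x]` in `A_h`, i.e. the centralizer of `x̄` in `A_h` is the subalgebra generated
by `x̄`. -/
theorem centralizer_x_in_Ah
    [CharZero k] (hne : h ≠ 0) (u : Ah k h) :
    u * ahX k h = ahX k h * u ↔ ∃ p : Polynomial k, u = Polynomial.aeval (ahX k h) p := by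
  open AhAux Polynomial in
  constructor
  · intro hu
    obtain ⟨f, hf⟩ : ∃ f, f = rho k h u (Finsupp.single 0 1) := ⟨_, rfl⟩
    have huN : u = N k h f := by
      have := N_rho k h u (Finsupp.single 0 1)
      rw [← hf] at this
      simpa [N_single] using this
    have key : ∀ m, X * f m = f.sum fun i p => p * (T k h ^ i) (Finsupp.single 0 X) m := by
      intro m
      rw [← rho_N, ← huN, ← mulP_apply, hf, ← rho_x k h, ← Module.End.mul_apply, ← map_mul, ← hu,
        map_mul, Module.End.mul_apply, rho_x]
      simp [mulP]
    have hz : ∀ m, f (m+1) = 0 := by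
      by_contra! hcon
      obtain ⟨j, hj⟩ := hcon
      have hle : ∀ i ∈ f.support, i ≤ f.support.sup id := fun i hi => Finset.le_sup (f := id) hi
      have hjs : j + 1 ≤ f.support.sup id := hle _ (by simpa using hj)
      obtain ⟨i, hi, hi2⟩ := Finset.exists_mem_eq_sup f.support ⟨j+1, by simpa using hj⟩ id
      obtain ⟨m, hm⟩ : ∃ m, f.support.sup id = m + 1 := ⟨f.support.sup id - 1, by omega⟩
      rw [hm] at hle hi2
      simp only [id] at hi2
      subst hi2
      have hk := key m
      rw [Finsupp.sum_of_support_subset f (s := Finset.range (m+2))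
        (fun i hi => Finset.mem_range.2 (by have := hle i hi; omega)) _ (by simp),
        Finset.sum_range_succ, Finset.sum_range_succ, (T_pow k h m).2.1, (T_pow k h m).2.2,
        Finset.sum_eq_zero (fun i hi => by
          rw [(T_pow k h i).1 m (Finset.mem_range.1 hi), mul_zero])] at hk
      have h0 : f (m+1) * (((m+1 : ℕ) : k[X]) * h) = 0 := by linear_combination -hk
      have hc : ((m+1 : ℕ) : k[X]) ≠ 0 := Nat.cast_ne_zero.2 (Nat.succ_ne_zero m)
      exact (Finsupp.mem_support_iff.1 hi) ((mul_eq_zero.1 h0).resolve_right (mul_ne_zero hc hne))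
    refine ⟨f 0, ?_⟩
    have : f = Finsupp.single 0 (f 0) := by
      ext1 n
      cases n <;> simp [hz]
    rw [huN, this, N_single]
    simp
  · rintro ⟨p, rfl⟩
    have := congrArg (aeval (ahX k h)) (mul_comm p X)
    simpa using this
end

section
/- In A_h, the image of the map u ↦ x̄u − ux̄ equals the right ideal generated by h̄; that is, for every w ∈ A_h, there exists u ∈ A_h with w = x̄u − ux̄ if and only if there exists v ∈ A_h with w = h̄v. -/
variable (k : Type) [Field k] (h : Polynomial k)

/-- The image `h̄` of `h(x)` in `A_h`. -/
noncomputable def ahH : Ah k h := Polynomial.aeval (ahX k h) h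

open Polynomial in
theorem ah_aux {k A : Type} [Field k] [CharZero k] [Ring A] [Algebra k A] (h : Polynomial k) (x y : A)
    (hyx : y * x = x * y + aeval x h)
    (hgen : ∀ S : Subalgebra k A, x ∈ S → y ∈ S → ∀ a, a ∈ S) (w : A) :
    (∃ u : A, w = x * u - u * x) ↔ (∃ v : A, w = aeval x h * v) := by
  have hcomm : ∀ f g : k[X], aeval x f * aeval x g = aeval x g * aeval x f := by
    intro f g
    rw [← map_mul, mul_comm, map_mul]
  have hxf : ∀ f : k[X], x * aeval x f = aeval x f * x := by
    intro f
    have := hcomm X f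
    simpa using this
  have hyf : ∀ f : k[X], y * aeval x f = aeval x f * y + aeval x (h * derivative f) := by
    intro f
    induction f using Polynomial.induction_on' with
    | add p q hp hq =>
      simp only [map_add, mul_add, add_mul, hp, hq]
      abel
    | monomial n a =>
      induction n generalizing a with
      | zero =>
        simp [monomial_zero_left, aeval_C]
        exact (Algebra.commutes a y).symm
      | succ n ih =>
        have e : (monomial (n+1) a : k[X]) = monomial n a * X := by
          rw [monomial_mul_X]
        rw [e, map_mul, aeval_X, ← mul_assoc, ih, derivative_mul, derivative_X, mul_one, mul_add,
          map_add, add_mul, mul_assoc, hyx, ← mul_assoc h, map_mul (aeval x) (h * _) X, aeval_X,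
          map_mul (aeval x) h (monomial n a), hcomm h (monomial n a)]
        noncomm_ring
  have hyh : y * aeval x h = aeval x h * (y + aeval x (derivative h)) := by
    rw [hyf, mul_add, map_mul]
  constructor
  · rintro ⟨u, rfl⟩
    -- the right ideal generated by h is two-sided
    have hleft : ∀ a : A, ∃ b, a * aeval x h = aeval x h * b := by
      intro a
      let S : Subalgebra k A :=
        { carrier := {a | ∃ b, a * aeval x h = aeval x h * b}
          mul_mem' := by
            rintro a b ⟨c, hc⟩ ⟨d, hd⟩
            exact ⟨c * d, by rw [mul_assoc, hd, ← mul_assoc, hc, mul_assoc]⟩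
          add_mem' := by
            rintro a b ⟨c, hc⟩ ⟨d, hd⟩
            exact ⟨c + d, by rw [add_mul, hd, hc, mul_add]⟩
          algebraMap_mem' := fun r => ⟨algebraMap k A r, Algebra.commutes _ _⟩ }
      exact hgen S ⟨x, hxf h⟩ ⟨_, hyh⟩ a
    let S : Subalgebra k A :=
      { carrier := {u | ∃ v, x * u - u * x = aeval x h * v}
        mul_mem' := by
          rintro a b ⟨c, hc⟩ ⟨d, hd⟩
          obtain ⟨e, he⟩ := hleft a
          refine ⟨c * b + e * d, ?_⟩
          have : x * (a * b) - a * b * x = (x * a - a * x) * b + a * (x * b - b * x) := by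
            noncomm_ring
          rw [this, hc, hd, ← mul_assoc a, he]
          noncomm_ring
        add_mem' := by
          rintro a b ⟨c, hc⟩ ⟨d, hd⟩
          refine ⟨c + d, ?_⟩
          rw [mul_add, mul_add, add_mul, ← hc, ← hd]
          abel
        algebraMap_mem' := fun r => ⟨0, by
          rw [Algebra.commutes, sub_self, mul_zero]⟩ }
    refine hgen S ⟨0, by simp⟩ ⟨-1, ?_⟩ u
    rw [hyx]; simp
  · rintro ⟨v, rfl⟩
    let F : ℕ → Submodule k A := fun n =>
      Submodule.span k {v | ∃ (f : k[X]) (i : ℕ), i < n ∧ v = aeval x f * y ^ i}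
    have hFgen : ∀ n (f : k[X]) i, i < n → aeval x f * y ^ i ∈ F n := fun n f i hi =>
      Submodule.subset_span ⟨f, i, hi, rfl⟩
    have hFmono : ∀ m n, m ≤ n → F m ≤ F n := by
      intro m n hmn
      apply Submodule.span_mono
      rintro _ ⟨f, i, hi, rfl⟩
      exact ⟨f, i, by omega, rfl⟩
    have hFp : ∀ n (g : k[X]) v, v ∈ F n → aeval x g * v ∈ F n := by
      intro n g v hv
      induction hv using Submodule.span_induction with
      | mem v hv =>
        obtain ⟨f, i, hi, rfl⟩ := hv
        rw [← mul_assoc, ← map_mul]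
        exact hFgen _ _ _ hi
      | zero => simp
      | add a b _ _ ha hb => rw [mul_add]; exact add_mem ha hb
      | smul c a _ ha => rw [mul_smul_comm]; exact Submodule.smul_mem _ _ ha
    have hFy : ∀ n v, v ∈ F n → y * v ∈ F (n+1) := by
      intro n v hv
      induction hv using Submodule.span_induction with
      | mem v hv =>
        obtain ⟨f, i, hi, rfl⟩ := hv
        rw [← mul_assoc, hyf, add_mul, mul_assoc, ← pow_succ']
        exact add_mem (hFgen _ _ _ (by omega)) (hFgen _ _ _ (by omega))
      | zero => simp
      | add a b _ _ ha hb => rw [mul_add]; exact add_mem ha hb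
      | smul c a _ ha => rw [mul_smul_comm]; exact Submodule.smul_mem _ _ ha
    have hbr : ∀ n : ℕ, ∃ r ∈ F n,
        x * y ^ (n+1) - y ^ (n+1) * x = - (aeval x h * (((n:k)+1) • y ^ n + r)) := by
      intro n
      induction n with
      | zero =>
        refine ⟨0, zero_mem _, ?_⟩
        simp [hyx]
      | succ n ih =>
        obtain ⟨r, hr, e⟩ := ih
        refine ⟨((n:k)+1) • (aeval x (derivative h) * y ^ n) + (y + aeval x (derivative h)) * r,
          ?_, ?_⟩
        · refine add_mem (Submodule.smul_mem _ _ (hFgen _ _ _ (by omega))) ?_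
          rw [add_mul]
          exact add_mem (hFy _ _ hr) (hFmono n _ (by omega) (hFp _ _ _ hr))
        · have e1 : x * y ^ (n+1+1) - y ^ (n+1+1) * x =
              (x * y - y * x) * y ^ (n+1) + y * (x * y ^ (n+1) - y ^ (n+1) * x) := by
            rw [pow_succ' y (n+1)]
            noncomm_ring
          rw [e1, e, hyx, mul_neg, ← mul_assoc y, hyh]
          have e2 : (y + aeval x (derivative h)) * (((n:k)+1) • y ^ n + r) =
              ((n:k)+1) • y ^ (n+1) + ((n:k)+1) • (aeval x (derivative h) * y ^ n)
                + (y + aeval x (derivative h)) * r := by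
            rw [mul_add, mul_smul_comm, add_mul y _ (y ^ n), ← pow_succ', smul_add]
          rw [mul_assoc (aeval x h), e2]
          have e3 : (((n+1:ℕ):k)+1) • y ^ (n+1) = ((n:k)+1) • y ^ (n+1) + y ^ (n+1) := by
            rw [add_smul _ 1, one_smul]; push_cast; rfl
          rw [e3]
          noncomm_ring
    have main : ∀ n, ∀ v ∈ F n, ∃ u, aeval x h * v = x * u - u * x := by
      intro n
      induction n with
      | zero =>
        intro v hv
        have : v = 0 := by simpa [F] using hv
        exact ⟨0, by simp [this]⟩
      | succ n ih =>
        intro v hv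
        induction hv using Submodule.span_induction with
        | mem v hv =>
          obtain ⟨f, i, hi, rfl⟩ := hv
          by_cases hin : i < n
          · exact ih _ (hFgen _ _ _ hin)
          obtain rfl : i = n := by omega
          obtain ⟨r, hr, e⟩ := hbr i
          obtain ⟨u, hu⟩ := ih _ (hFp _ f r hr)
          have hc : ((i:k)+1) ≠ 0 := by exact_mod_cast Nat.succ_ne_zero i
          have e1 : x * (aeval x f * y ^ (i+1)) - (aeval x f * y ^ (i+1)) * x
              = - (((i:k)+1) • (aeval x h * (aeval x f * y ^ i)))
                - aeval x h * (aeval x f * r) := by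
            rw [← mul_assoc x, hxf, mul_assoc, mul_assoc, ← mul_sub, e, mul_neg, ← mul_assoc, hcomm f h,
              mul_assoc, mul_add, mul_add, mul_smul_comm, mul_smul_comm]
            abel
          rw [hu] at e1
          refine ⟨((i:k)+1)⁻¹ • (- (aeval x f * y ^ (i+1)) - u), ?_⟩
          rw [mul_smul_comm, smul_mul_assoc, ← smul_sub, eq_inv_smul_iff₀ hc]
          have e4 := eq_sub_of_add_eq (sub_eq_iff_eq_add.mp e1.symm).symm
          rw [neg_eq_iff_eq_neg.mp (sub_eq_iff_eq_add.mp e1.symm)]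
          noncomm_ring
        | zero => exact ⟨0, by simp⟩
        | add a b _ _ ha hb =>
          obtain ⟨c, hc⟩ := ha
          obtain ⟨d, hd⟩ := hb
          exact ⟨c + d, by rw [mul_add, hc, hd]; noncomm_ring⟩
        | smul c a _ ha =>
          obtain ⟨d, hd⟩ := ha
          exact ⟨c • d, by rw [mul_smul_comm, hd, mul_smul_comm, smul_mul_assoc, smul_sub]⟩
    have hall : ∀ a : A, ∀ n, ∀ v ∈ F n, ∃ m, a * v ∈ F m := by
      intro a
      let S : Subalgebra k A :=
        { carrier := {a | ∀ n, ∀ v ∈ F n, ∃ m, a * v ∈ F m}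
          mul_mem' := by
            intro a b ha hb n v hv
            obtain ⟨m, hm⟩ := hb n v hv
            rw [mul_assoc]
            exact ha m _ hm
          add_mem' := by
            intro a b ha hb n v hv
            obtain ⟨m, hm⟩ := ha n v hv
            obtain ⟨p, hp⟩ := hb n v hv
            refine ⟨m + p, ?_⟩
            rw [add_mul]
            exact add_mem (hFmono m _ (by omega) hm) (hFmono p _ (by omega) hp)
          algebraMap_mem' := by
            intro r n v hv
            refine ⟨n, ?_⟩
            rw [← Algebra.smul_def]
            exact Submodule.smul_mem _ _ hv }
      refine hgen S ?_ ?_ a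
      · intro n v hv
        exact ⟨n, by simpa using hFp n X v hv⟩
      · intro n v hv
        exact ⟨n+1, hFy n v hv⟩
    obtain ⟨m, hm⟩ := hall v 1 1 (by simpa using hFgen 1 1 0 (by omega))
    rw [mul_one] at hm
    exact main m v hm

/-- In `A_h`, the image of the map `u ↦ x̄u − ux̄` equals the right ideal generated
by `h̄`: for every `w ∈ A_h` there is `u` with `w = x̄u − ux̄` iff there is `v` with
`w = h̄v`. -/
theorem image_bracket_x_eq_right_ideal_h
    [CharZero k] (hne : h ≠ 0) (w : Ah k h) :
    (∃ u : Ah k h, w = ahX k h * u - u * ahX k h) ↔ (∃ v : Ah k h, w = ahH k h * v) := by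
  refine ah_aux h (ahX k h) (RingQuot.mkAlgHom k (AhRel k h) (FreeAlgebra.ι k 1)) ?_ ?_ w
  · have := RingQuot.mkAlgHom_rel k (AhRel.rel (k := k) (h := h))
    rw [map_mul, map_add, map_mul, ← Polynomial.aeval_algHom_apply] at this
    exact this
  · intro S hx hy a
    obtain ⟨b, rfl⟩ := RingQuot.mkAlgHom_surjective k (AhRel k h) a
    induction b using FreeAlgebra.induction with
    | grade0 r => rw [AlgHom.commutes]; exact S.algebraMap_mem r
    | grade1 i =>
      fin_cases i
      · exact hx
      · exact hy
    | mul a b ha hb => rw [map_mul]; exact S.mul_mem ha hb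
    | add a b ha hb => rw [map_add]; exact S.add_mem ha hb
end

section
/- The center of A_h consists exactly of the scalar multiples of the identity; that is, an element u ∈ A_h commutes with every element of A_h if and only if u ∈ k·1. (Equivalently, HH⁰(A_h) ≅ k.) -/
open Polynomial in
theorem AhAux.main (k : Type) [Field k] [CharZero k] (h : Polynomial k) (hne : h ≠ 0)
    {A : Type} [Ring A] [Algebra k A] (x y : A) (hyx : y * x = x * y + aeval x h)
    (ρ : A →ₐ[k] Module.End k k[X])
    (hρx : ρ x = LinearMap.mulLeft k X)
    (hρy : ρ y = LinearMap.mulLeft k h ∘ₗ derivative)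
    (u : A) (hspan : ∃ p : k[X][X], u = p.eval₂ (aeval x : k[X] →ₐ[k] A).toRingHom y)
    (hux : u * x = x * u) (huy : u * y = y * u) : ∃ c : k, u = algebraMap k A c := by
  have hρ : ∀ f : k[X], ρ (aeval x f) 1 = f := by
    intro f
    have h1 : ρ (aeval x f) = LinearMap.mulLeft k f := by
      have : (ρ.comp (aeval x)) = (Algebra.lmul k k[X]) := by
        ext1
        simp [hρx]
        rfl
      exact congrArg (fun g => g f) this
    simp [h1]
  have hinj : ∀ f : k[X], aeval x f = 0 → f = 0 := by
    intro f hf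
    rw [← hρ f, hf]; simp
  let D : Module.End k A := LinearMap.mulRight k x - LinearMap.mulLeft k x
  have hD : ∀ z, D z = z * x - x * z := fun z => rfl
  have hcx : ∀ f : k[X], aeval x f * x = x * aeval x f := by
    intro f
    have := congrArg (aeval x) (mul_comm f X)
    simpa using this
  have hDf : ∀ (f : k[X]) z, D (aeval x f * z) = aeval x f * D z := by
    intro f z
    rw [hD, hD, mul_sub, ← mul_assoc x, ← hcx]
    simp only [mul_assoc]
  have hDfm : ∀ (m : ℕ) (f : k[X]) z, (D ^ m) (aeval x f * z) = aeval x f * (D ^ m) z := by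
    intro m
    induction m with
    | zero => intro f z; simp
    | succ m ih => intro f z; rw [pow_succ]; simp only [Module.End.mul_apply]; rw [hDf, ih]
  have hDy : ∀ z, D (y * z) = y * D z + aeval x h * z := by
    intro z
    have : aeval x h = y * x - x * y := by rw [hyx]; abel
    rw [hD, hD, this]; noncomm_ring
  have hDym : ∀ (m : ℕ) z, (D ^ (m+1)) (y * z) =
      y * (D ^ (m+1)) z + ((m+1 : ℕ) : k) • (aeval x h * (D ^ m) z) := by
    intro m
    induction m with
    | zero => intro z; simp [hDy]
    | succ m ih =>
      intro z
      rw [pow_succ' D (m+1)]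
      simp only [Module.End.mul_apply]
      rw [ih, map_add, map_smul, hDf, hDy, ← Module.End.mul_apply, ← Module.End.mul_apply,
        ← pow_succ' D m, Nat.cast_succ (m+1), add_smul, one_smul, add_assoc]
      congr 1
      abel
  have hDyn : ∀ n : ℕ, (D ^ (n+1)) (y ^ n) = 0 ∧
      (D ^ n) (y ^ n) = (n.factorial : k) • aeval x (h ^ n) := by
    intro n
    induction n with
    | zero => simp [hD]
    | succ n ih =>
      rw [pow_succ' y, hDym, hDym, ih.1, ih.2, pow_succ' D (n+1), Module.End.mul_apply, ih.1]
      refine ⟨by simp, ?_⟩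
      rw [Nat.factorial_succ, pow_succ' h]
      simp [smul_smul]
  have hDlt : ∀ m n : ℕ, n < m → (D ^ m) (y ^ n) = 0 := by
    intro m n hmn
    obtain ⟨d, rfl⟩ := Nat.exists_eq_add_of_lt hmn
    rw [show n + d + 1 = d + (n+1) by ring, pow_add, Module.End.mul_apply, (hDyn n).1, map_zero]
  obtain ⟨p, hp⟩ := hspan
  have hp' : u = ∑ i ∈ Finset.range (p.natDegree + 1), aeval x (p.coeff i) * y ^ i := by
    rw [hp, eval₂_eq_sum_range]; rfl
  have hdeg : p.natDegree = 0 := by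
    by_contra hn
    have h0 : (D ^ p.natDegree) u = 0 := by
      obtain ⟨m, hm⟩ := Nat.exists_eq_succ_of_ne_zero hn
      rw [hm, Nat.succ_eq_add_one, pow_succ, Module.End.mul_apply, hD, hux, sub_self, map_zero]
    rw [hp', map_sum, Finset.sum_range_succ, Finset.sum_eq_zero, zero_add, hDfm, (hDyn _).2,
      mul_smul_comm, ← map_mul] at h0
    · rw [smul_eq_zero] at h0
      rcases h0 with h0 | h0
      · exact Nat.factorial_ne_zero _ (by exact_mod_cast h0)
      · have := hinj _ h0
        rw [mul_eq_zero] at this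
        rcases this with h1 | h1
        · have : p = 0 := leadingCoeff_eq_zero.mp h1
          exact hn (by simp [this])
        · exact hne (pow_eq_zero_iff hn |>.mp h1)
    · intro i hi
      rw [hDfm, hDlt _ _ (Finset.mem_range.mp hi), mul_zero]
  rw [hdeg] at hp'
  simp at hp'
  have h2 := congrArg (fun z => ρ z 1) huy
  simp only [map_mul, Module.End.mul_apply, hρy] at h2
  rw [hp', hρ] at h2
  simp [hne] at h2
  refine ⟨(p.coeff 0).coeff 0, ?_⟩
  rw [hp', eq_C_of_natDegree_eq_zero h2]
  simp

open Polynomial in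
theorem AhAux.span (k : Type) [Field k] (h : Polynomial k) 
    {A : Type} [Ring A] [Algebra k A] (x y : A) (hyx : y * x = x * y + aeval x h)
    (w : FreeAlgebra k (Fin 2)) :
    ∃ p : k[X][X], FreeAlgebra.lift k ![x, y] w =
      p.eval₂ (aeval x : k[X] →ₐ[k] A).toRingHom y := by
  have hyf : ∀ f : k[X], y * aeval x f = aeval x f * y + aeval x (derivative f * h) := by
    intro f
    induction f using Polynomial.induction_on' with
    | add p q hp hq => simp only [map_add, mul_add, add_mul, hp, hq]; abel
    | monomial n a =>
      induction n generalizing a with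
      | zero => simp [Algebra.commutes]
      | succ n ih =>
        rw [← monomial_mul_X, map_mul, ← mul_assoc, ih, derivative_mul, add_mul, mul_assoc, aeval_X,
          hyx, derivative_X, mul_one]
        simp only [add_mul, mul_add, map_add, map_mul, aeval_X, mul_assoc]
        rw [show aeval x h * x = x * aeval x h by
          simpa using congrArg (aeval x) (mul_comm h X)]
        abel
  let φ : k[X] →+* A := (aeval x : k[X] →ₐ[k] A).toRingHom
  have hφ : ∀ f, φ f = aeval x f := fun _ => rfl
  have key : ∀ q : k[X][X], ∃ p : k[X][X], FreeAlgebra.lift k ![x, y] w * q.eval₂ φ y =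
      p.eval₂ φ y := by
    induction w using FreeAlgebra.induction with
    | grade0 r =>
      intro q
      refine ⟨C (C r) * q, ?_⟩
      induction q using Polynomial.induction_on' with
      | add p q hp hq => simp only [mul_add, eval₂_add, hp, hq]
      | monomial n a => 
        rw [C_mul_monomial, eval₂_monomial, eval₂_monomial, map_mul, hφ (C r)]; simp [mul_assoc]
    | grade1 i =>
      fin_cases i
      · intro q
        refine ⟨C X * q, ?_⟩
        induction q using Polynomial.induction_on' with
        | add p q hp hq => simp only [mul_add, eval₂_add, hp, hq]
        | monomial n a => 
          rw [C_mul_monomial, eval₂_monomial, eval₂_monomial, map_mul, hφ X]; simp [mul_assoc]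
      · intro q
        induction q using Polynomial.induction_on' with
        | add p q hp hq =>
          obtain ⟨p', hp⟩ := hp
          obtain ⟨q', hq⟩ := hq
          exact ⟨p' + q', by simp only [mul_add, eval₂_add, hp, hq]⟩
        | monomial n a => 
          refine ⟨monomial (n+1) a + monomial n (derivative a * h), ?_⟩
          rw [eval₂_add, eval₂_monomial, eval₂_monomial, eval₂_monomial, hφ, hφ, pow_succ']
          have := hyf a
          simp only [FreeAlgebra.lift_ι_apply]
          change y * _ = _
          rw [← mul_assoc, this, add_mul, mul_assoc]
    | mul a b ha hb =>
      intro q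
      obtain ⟨p, hp⟩ := hb q
      obtain ⟨p', hp'⟩ := ha p
      exact ⟨p', by rw [map_mul, mul_assoc, hp, hp']⟩
    | add a b ha hb =>
      intro q
      obtain ⟨p, hp⟩ := hb q
      obtain ⟨p', hp'⟩ := ha q
      exact ⟨p' + p, by rw [map_add, add_mul, hp, hp', eval₂_add]⟩
  obtain ⟨p, hp⟩ := key 1
  rw [eval₂_one, mul_one] at hp
  exact ⟨p, hp⟩

open Polynomial in
theorem AhAux.rep (k : Type) [Field k] (h : Polynomial k) :
    ∃ ρ : Ah k h →ₐ[k] Module.End k k[X],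
      ρ (RingQuot.mkAlgHom k (AhRel k h) (FreeAlgebra.ι k 0)) = LinearMap.mulLeft k X ∧
      ρ (RingQuot.mkAlgHom k (AhRel k h) (FreeAlgebra.ι k 1)) =
        LinearMap.mulLeft k h ∘ₗ derivative := by
  let g : FreeAlgebra k (Fin 2) →ₐ[k] Module.End k k[X] :=
    FreeAlgebra.lift k ![LinearMap.mulLeft k X, LinearMap.mulLeft k h ∘ₗ derivative]
  have g0 : g (FreeAlgebra.ι k 0) = LinearMap.mulLeft k X := by simp [g]
  have g1 : g (FreeAlgebra.ι k 1) = LinearMap.mulLeft k h ∘ₗ derivative := by simp [g]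
  have hg : ∀ ⦃a b⦄, AhRel k h a b → g a = g b := by
    rintro _ _ ⟨⟩
    have h1 : aeval (LinearMap.mulLeft k (X : k[X])) h = LinearMap.mulLeft k h := by
      have : aeval (LinearMap.mulLeft k (X : k[X])) = (Algebra.lmul k k[X]) := by
        ext1
        simp
        rfl
      exact congrArg (fun g => g h) this
    rw [map_add, map_mul, map_mul, ← aeval_algHom_apply, g0, g1, h1]
    refine LinearMap.ext fun f => ?_
    simp only [Module.End.mul_apply, LinearMap.comp_apply, LinearMap.mulLeft_apply,
      LinearMap.add_apply, derivative_mul, derivative_X]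
    ring
  refine ⟨RingQuot.liftAlgHom k ⟨g, hg⟩, ?_, ?_⟩
  · rw [RingQuot.liftAlgHom_mkAlgHom_apply, g0]
  · rw [RingQuot.liftAlgHom_mkAlgHom_apply, g1]

/-- An element `u ∈ A_h` commutes with every element of `A_h` if and only if `u` is a
scalar multiple of the identity; i.e. `HH⁰(A_h) ≅ k`. -/
theorem center_Ah_eq_scalars
    (k : Type) [Field k] [CharZero k] (h : Polynomial k) (hne : h ≠ 0) (u : Ah k h) :
    (∀ v : Ah k h, u * v = v * u) ↔ ∃ c : k, u = algebraMap k (Ah k h) c := by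
  constructor
  · intro hu
    obtain ⟨ρ, h0, h1⟩ := AhAux.rep k h
    have hyx := RingQuot.mkAlgHom_rel k (AhRel.rel (k := k) (h := h))
    rw [map_add, map_mul, map_mul, ← Polynomial.aeval_algHom_apply] at hyx
    refine AhAux.main k h hne _ _ hyx ρ h0 h1 u ?_ (hu _) (hu _)
    obtain ⟨w, rfl⟩ := RingQuot.mkAlgHom_surjective k (AhRel k h) u
    obtain ⟨p, hp⟩ := AhAux.span k h _ _ hyx w
    refine ⟨p, ?_⟩
    rw [← hp]
    congr 1
    ext i
    fin_cases i <;> simp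
  · rintro ⟨c, rfl⟩ v
    exact Algebra.commutes c v
end
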